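/- arXiv:2512.07087 — 16 statements merged into one kernel-verified Lean document; each statement's English description precedes it below -/
import Mathlib

section
/- There exists a magma (M, ⋄) satisfying Equation73 but not satisfying Equation4380. (Proposition 'E73 does not imply E4380', proved by a greedy extension construction.) -/
structure GoodRel (R : ℕ → ℕ → ℕ → Prop) : Prop where
  func : ∀ x y z z', R x y z → R x y z' → z = z'
  inj : ∀ x x' y z, R x y z → R x' y z → x = x'
  ne : ∀ x y, ¬ R x y y
  law : ∀ x y z w, R x y z → R y z w → R y w x
  bdd : ∃ N, ∀ x y z, R x y z → x < N ∧ y < N ∧ z < N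

theorem GoodRel.extend {R : ℕ → ℕ → ℕ → Prop} (h : GoodRel R) (a b : ℕ) :
    ∃ R' : ℕ → ℕ → ℕ → Prop, GoodRel R' ∧ (∀ x y z, R x y z → R' x y z) ∧ ∃ c, R' a b c := by
  by_cases hab : ∃ c, R a b c
  · exact ⟨R, h, fun _ _ _ h => h, hab⟩
  obtain ⟨f, i, n, l, N, hN⟩ := h
  obtain ⟨c, hc, hca, hcb⟩ : ∃ c, N ≤ c ∧ a < c ∧ b < c := ⟨N + a + b + 1, by omega, by omega, by omega⟩
  have hb : ∀ x y z, R x y z → x < c ∧ y < c ∧ z < c := fun x y z h => by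
    have := hN x y z h; omega
  have hab' : ∀ z, ¬ R a b z := fun z hz => hab ⟨z, hz⟩
  refine ⟨fun x y z => R x y z ∨ (x = a ∧ y = b ∧ z = c) ∨ (x = a ∧ y = c ∧ R z a b),
    ⟨?_, ?_, ?_, ?_, c + 1, ?_⟩, fun _ _ _ h => Or.inl h, c, by simp⟩
  · rintro x y z z' (h | ⟨rfl, rfl, rfl⟩ | ⟨rfl, rfl, h⟩) (h' | ⟨h1, h2, h3⟩ | ⟨h1, h2, h3⟩) <;> grind
  · rintro x y z z' (h | ⟨rfl, rfl, rfl⟩ | ⟨rfl, rfl, h⟩) (h' | ⟨h1, h2, h3⟩ | ⟨h1, h2, h3⟩) <;> grind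
  · rintro x y (h | ⟨h1, h2, h3⟩ | ⟨h1, h2, h3⟩) <;> grind
  · rintro x y z w (h | ⟨h1, h2, h3⟩ | ⟨h1, h2, h3⟩) (h' | ⟨h1', h2', h3'⟩ | ⟨h1', h2', h3'⟩) <;> grind
  · rintro x y z (h | ⟨h1, h2, h3⟩ | ⟨h1, h2, h3⟩) <;> grind

def seedRel (x y z : ℕ) : Prop :=
  (x = 0 ∧ y = 0 ∧ z = 1) ∨ (x = 0 ∧ y = 1 ∧ z = 2) ∨ (x = 0 ∧ y = 2 ∧ z = 0) ∨
    (x = 1 ∧ y = 0 ∧ z = 3)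

theorem seedRel_good : GoodRel seedRel := by
  refine ⟨?_, ?_, ?_, ?_, 4, ?_⟩ <;> unfold seedRel <;> intros <;> omega

/-- There exists a magma satisfying Equation73 (`∀ x y, x = y ⋄ (y ⋄ (x ⋄ y))`)
but not Equation4380 (`∀ x, x ⋄ (x ⋄ x) = (x ⋄ x) ⋄ x`). -/
theorem Equation73_not_implies_Equation4380 :
    ∃ (M : Type) (op : M → M → M),
      (∀ x y : M, x = op y (op y (op x y))) ∧
      ¬ (∀ x : M, op x (op x x) = op (op x x) x) := by
  have key : ∀ (S : {R // GoodRel R}) (n : ℕ), ∃ S' : {R // GoodRel R},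
      (∀ x y z, S.1 x y z → S'.1 x y z) ∧ ∃ c, S'.1 n.unpair.1 n.unpair.2 c := by
    rintro ⟨R, h⟩ n
    obtain ⟨R', h1, h2⟩ := h.extend n.unpair.1 n.unpair.2
    exact ⟨⟨R', h1⟩, h2⟩
  choose next hsub hdef using key
  let T : ℕ → {R // GoodRel R} := fun n => Nat.rec ⟨seedRel, seedRel_good⟩ (fun n S => next S n) n
  have hT : ∀ n, T (n + 1) = next (T n) n := fun n => rfl
  have mono : ∀ m n, m ≤ n → ∀ x y z, (T m).1 x y z → (T n).1 x y z := by
    intro m n hmn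
    induction n, hmn using Nat.le_induction with
    | base => exact fun _ _ _ h => h
    | succ n _ ih => intro x y z h; rw [hT]; exact hsub _ _ _ _ _ (ih _ _ _ h)
  have tot : ∀ x y, ∃ c n, (T n).1 x y c := by
    intro x y
    obtain ⟨c, hc⟩ := hdef (T (Nat.pair x y)) (Nat.pair x y)
    rw [← hT, Nat.unpair_pair] at hc
    exact ⟨c, Nat.pair x y + 1, hc⟩
  choose op lev hop using tot
  have uniq : ∀ n x y z, (T n).1 x y z → op x y = z := by
    intro n x y z h
    exact (T (max n (lev x y))).2.func x y _ _ (mono _ _ (le_max_right _ _) _ _ _ (hop x y))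
      (mono _ _ (le_max_left _ _) _ _ _ h)
  refine ⟨ℕ, op, ?_, ?_⟩
  · intro x y
    symm
    exact uniq (max (lev x y) (lev y (op x y))) _ _ _ ((T _).2.law _ _ _ _
      (mono _ _ (le_max_left _ _) _ _ _ (hop x y))
      (mono _ _ (le_max_right _ _) _ _ _ (hop y (op x y))))
  · intro h
    have h0 := h 0
    have e1 : op 0 0 = 1 := uniq 0 _ _ _ (show seedRel 0 0 1 by simp [seedRel])
    have e2 : op 0 1 = 2 := uniq 0 _ _ _ (show seedRel 0 1 2 by simp [seedRel])
    have e3 : op 1 0 = 3 := uniq 0 _ _ _ (show seedRel 1 0 3 by simp [seedRel])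
    rw [e1, e2, e3] at h0
    omega
end

section
/- There exists a finite magma (M, ⋄) satisfying Equation1110 but not satisfying Equation1629. (Proposition 'E1110 does not imply E1629, even for finite magmas', proved via an affine extension of the linear magma x ⋄ y = 3x − y on ℤ/5ℤ by a magma-cohomology cocycle.) -/
/-- The cocycle on `ℤ/5ℤ`. -/
def cocyc (x y : Fin 5) : Fin 5 :=
  (![![2, 4, 3, 1, 3], ![1, 1, 1, 2, 0], ![1, 3, 3, 2, 3], ![2, 0, 2, 0, 0],
    ![1, 0, 0, 0, 0]] : Fin 5 → Fin 5 → Fin 5) x y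

/-- The affine extension of `x ⋄ y = 3x - y`. -/
def extOp (x y : Fin 5 × Fin 5) : Fin 5 × Fin 5 :=
  (3 * x.1 - y.1, 3 * x.2 - y.2 + cocyc x.1 y.1)

/-- There exists a finite magma satisfying Equation1110
(`∀ x y, x = y ⋄ ((y ⋄ (x ⋄ x)) ⋄ y)`) but not Equation1629
(`∀ x, x = (x ⋄ x) ⋄ ((x ⋄ x) ⋄ x)`). -/
theorem Equation1110_not_implies_Equation1629_finite :
    ∃ (M : Type) (op : M → M → M), Finite M ∧
      (∀ x y : M, x = op y (op (op y (op x x)) y)) ∧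
      ¬ (∀ x : M, x = op (op x x) (op (op x x) x)) := by
  refine ⟨Fin 5 × Fin 5, extOp, inferInstance, ?_, ?_⟩
  · decide +kernel
  · decide +kernel
end

section
/- There exists a magma (M, ⋄) satisfying Equation1659 but not satisfying Equation4315. (Proposition 'E1659 does not imply E4315'.) -/
/-- There exists a magma satisfying Equation1659
(`∀ x y z, x = (x ⋄ y) ⋄ ((y ⋄ y) ⋄ z)`) but not Equation4315
(`∀ x y z, x ⋄ (y ⋄ x) = x ⋄ (y ⋄ z)`). -/
theorem Equation1659_not_implies_Equation4315 :
    ∃ (M : Type) (op : M → M → M),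
      (∀ x y z : M, x = op (op x y) (op (op y y) z)) ∧
      ¬ (∀ x y z : M, op x (op y x) = op x (op y z)) := by
  refine ⟨ℤ, fun x y => if y % 2 = 1 ∧ 0 < y then (if x % 2 = 1 then x + 1 else x - 1)
    else (if x % 2 = 1 then x - 1 else x + 1), ?_, ?_⟩
  · intro x y z
    dsimp only
    split_ifs <;> omega
  · intro h
    have := h 0 0 1
    norm_num at this
end

section
/- The magma with carrier ℤ and operation m ⋄ n defined by m ⋄ n = −m if n < 0 and m ⋄ n = −m − 1 if n ≥ 0 satisfies Equation1659 but does not satisfy Equation4315. -/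
/-- The magma operation on ℤ given by `m ⋄ n = -m` if `n < 0` and `m ⋄ n = -m - 1`
if `n ≥ 0`. -/
def intOp (m n : ℤ) : ℤ := if n < 0 then -m else -m - 1

/-- The magma `(ℤ, intOp)` satisfies Equation1659
(`∀ x y z, x = (x ⋄ y) ⋄ ((y ⋄ y) ⋄ z)`) but not Equation4315
(`∀ x y z, x ⋄ (y ⋄ x) = x ⋄ (y ⋄ z)`). -/
theorem intOp_Equation1659_not_Equation4315 :
    (∀ x y z : ℤ, x = intOp (intOp x y) (intOp (intOp y y) z)) ∧
    ¬ (∀ x y z : ℤ, intOp x (intOp y x) = intOp x (intOp y z)) := by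
  constructor
  · intro x y z
    unfold intOp
    split_ifs <;> omega
  · intro h
    have := h 0 0 (-1)
    simp [intOp] at this
end

section
/- Every magma satisfying Equation854 also satisfies Equation378; that is, if ∀ x y z, x = x ⋄ ((y ⋄ z) ⋄ (x ⋄ z)), then ∀ x y, x ⋄ y = (x ⋄ y) ⋄ y. (Lemma on the law E854.) -/
/-- Every magma satisfying Equation854 (`∀ x y z, x = x ⋄ ((y ⋄ z) ⋄ (x ⋄ z))`)
also satisfies Equation378 (`∀ x y, x ⋄ y = (x ⋄ y) ⋄ y`). -/
theorem Equation854_implies_Equation378 (M : Type*) (op : M → M → M)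
    (h : ∀ x y z : M, x = op x (op (op y z) (op x z))) :
    ∀ x y : M, op x y = op (op x y) y := by
  intro x y
  have h1 : op y (op y y) = y := by
    have a := h y y (op (op y y) (op y y))
    rw [← h y y y] at a
    exact a.symm
  have h2 : op y (op (op x y) (op y y)) = y := (h y x y).symm
  have h3 := h (op x y) y (op y y)
  rw [h1, h2] at h3
  exact h3
end

section
/- There exists a magma (M, ⋄) satisfying Equation854 but not satisfying Equation3316. (Proposition 'E854 does not imply E3316', proved via unique factorization in the free magma on the law E854.) -/
inductive TT : Type
  | g : TT
  | h : TT
  | n : TT → TT → TT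

namespace TT

def sz : TT → ℕ
  | g => 1
  | h => 1
  | n a b => sz a + sz b + 1

def R (x w : TT) : Prop :=
  (match w with
   | n u v => (v = x ∧ ¬ (u = g ∧ x = h)) ∨
      (match v with
       | n a c => a = x ∧ ((∃ b, u = n b c) ∨ R u c) ∧ ¬ R x c
       | _ => False)
   | _ => False) ∨
  (match x with
   | n u v => v = w ∨
      (match v with
       | n a c => a = w ∧ ((∃ b, u = n b c) ∨ R u c) ∧ ¬ R w c
       | _ => False)
   | _ => False)
termination_by sz x + sz w
decreasing_by all_goals simp only [sz]; omega

theorem R_iff (x w : TT) : R x w ↔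
    (∃ p, x = n p w) ∨ (∃ u, w = n u x ∧ ¬ (u = g ∧ x = h)) ∨
    (∃ u c, w = n u (n x c) ∧ ((∃ b, u = n b c) ∨ R u c) ∧ ¬ R x c) ∨
    (∃ u c, x = n u (n w c) ∧ ((∃ b, u = n b c) ∨ R u c) ∧ ¬ R w c) := by
  constructor
  · intro hR
    rw [R.eq_def] at hR
    rcases hR with hR | hR
    · rcases w with _ | _ | ⟨u, v⟩
      · exact hR.elim
      · exact hR.elim
      · rcases hR with ⟨rfl, h1⟩ | hR
        · exact Or.inr (Or.inl ⟨u, rfl, h1⟩)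
        · rcases v with _ | _ | ⟨a, c⟩
          · exact hR.elim
          · exact hR.elim
          · obtain ⟨rfl, h1, h2⟩ := hR
            exact Or.inr (Or.inr (Or.inl ⟨u, c, rfl, h1, h2⟩))
    · rcases x with _ | _ | ⟨u, v⟩
      · exact hR.elim
      · exact hR.elim
      · rcases hR with rfl | hR
        · exact Or.inl ⟨u, rfl⟩
        · rcases v with _ | _ | ⟨a, c⟩
          · exact hR.elim
          · exact hR.elim
          · obtain ⟨rfl, h1, h2⟩ := hR
            exact Or.inr (Or.inr (Or.inr ⟨u, c, rfl, h1, h2⟩))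
  · rintro (⟨p, rfl⟩ | ⟨u, rfl, h1⟩ | ⟨u, c, rfl, h1, h2⟩ | ⟨u, c, rfl, h1, h2⟩)
    · rw [R.eq_def]; exact Or.inr (Or.inl rfl)
    · rw [R.eq_def]; exact Or.inl (Or.inl ⟨rfl, h1⟩)
    · rw [R.eq_def]; exact Or.inl (Or.inr ⟨rfl, h1, h2⟩)
    · rw [R.eq_def]; exact Or.inr (Or.inr ⟨rfl, h1, h2⟩)

theorem D1 (p w : TT) : R (n p w) w := (R_iff _ _).2 (Or.inl ⟨p, rfl⟩)
theorem U0 (u x : TT) (h1 : ¬ (u = g ∧ x = h)) : R x (n u x) :=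
  (R_iff _ _).2 (Or.inr (Or.inl ⟨u, rfl, h1⟩))
theorem U1 (u x c : TT) (h1 : (∃ b, u = n b c) ∨ R u c) (h2 : ¬ R x c) :
    R x (n u (n x c)) :=
  (R_iff _ _).2 (Or.inr (Or.inr (Or.inl ⟨u, c, rfl, h1, h2⟩)))
theorem D2 (u x c : TT) (h1 : (∃ b, u = n b c) ∨ R u c) (h2 : ¬ R x c) :
    R (n u (n x c)) x :=
  (R_iff _ _).2 (Or.inr (Or.inr (Or.inr ⟨u, c, rfl, h1, h2⟩)))

theorem ne_sz {a b : TT} (e : a = b) : sz a = sz b := congrArg sz e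

theorem irr (x : TT) : ¬ R x x := by
  rw [R_iff]
  rintro (⟨p, e⟩ | ⟨u, e, -⟩ | ⟨u, c, e, -⟩ | ⟨u, c, e, -⟩) <;>
  · have := ne_sz e
    simp only [sz] at this
    omega

theorem no_common (z : TT) (h1 : R g z) (h2 : R h z) : False := by
  rw [R_iff] at h1 h2
  rcases h1 with ⟨p, e⟩ | ⟨u, e, -⟩ | ⟨u, c, e, -⟩ | ⟨u, c, e, -⟩ <;>
  rcases h2 with ⟨p', e'⟩ | ⟨u', e', -⟩ | ⟨u', c', e', -⟩ | ⟨u', c', e', -⟩ <;>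
  simp_all

theorem no_common' (z : TT) (h1 : R (n g h) z) (h2 : R h z) : False := by
  rw [R_iff] at h1 h2
  rcases h1 with ⟨p, e⟩ | ⟨u, e, -⟩ | ⟨u, c, e, -⟩ | ⟨u, c, e, -⟩ <;>
  rcases h2 with ⟨p', e'⟩ | ⟨u', e', -⟩ | ⟨u', c', e', -⟩ | ⟨u', c', e', -⟩ <;>
  (cases e <;> cases e')

/-- `y` fixed by a pair starting with `y`. -/
theorem R_left {y c : TT} (hR : R y (n y c)) : c = y := by
  rw [R_iff] at hR
  rcases hR with ⟨p, e⟩ | ⟨u, e, -⟩ | ⟨u, c', e, h1, h2⟩ | ⟨u, c', e, -⟩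
  · have := ne_sz e
    simp only [sz] at this
    omega
  · injection e
  · injection e with e1 e2
    subst e1
    rcases h1 with ⟨b, rfl⟩ | h1
    · exact (h2 (D1 _ _)).elim
    · exact (h2 h1).elim
  · have := ne_sz e
    simp only [sz] at this
    omega

open Classical in
noncomputable def op (x y : TT) : TT := if R x y then x else n x y

theorem op_cases (x y : TT) : (R x y ∧ op x y = x) ∨ (¬ R x y ∧ op x y = n x y) := by
  unfold op
  split_ifs with hh
  · exact Or.inl ⟨hh, rfl⟩
  · exact Or.inr ⟨hh, rfl⟩

/-- Collapsed case. -/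
theorem coll (x y z u v : TT) (hu : (R y z ∧ u = y) ∨ (¬ R y z ∧ u = n y z))
    (hv : (R x z ∧ v = x) ∨ (¬ R x z ∧ v = n x z)) (hR : R u v) : R x u := by
  have hR' := hR
  rw [R_iff] at hR
  rcases hR with ⟨s, e⟩ | ⟨s, e, hs⟩ | ⟨s, c, e, h1, h2⟩ | ⟨s, c, e, h1, h2⟩
  · -- u = (s, v)
    rcases hv with ⟨hv, rfl⟩ | ⟨hv, rfl⟩
    · rw [e]
      by_cases hgh : s = g ∧ v = h
      · obtain ⟨rfl, rfl⟩ := hgh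
        rcases hu with ⟨hu, rfl⟩ | ⟨hu, rfl⟩
        · subst e
          exfalso
          exact no_common' _ hu hv
        · injection e with e1 e2
          subst e2
          exact (irr _ hv).elim
      · exact U0 _ _ hgh
    · rcases hu with ⟨hu, rfl⟩ | ⟨hu, rfl⟩
      · subst e
        rw [R_iff] at hu
        rcases hu with ⟨p, e⟩ | ⟨p, e, -⟩ | ⟨p, c, e, -⟩ | ⟨p, c, e, h1, h2⟩
        · injection e with e1 e2
          have := ne_sz e2
          simp only [sz] at this
          omega
        · have := ne_sz e
          simp only [sz] at this
          omega
        · have := ne_sz e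
          simp only [sz] at this
          omega
        · injection e with e1 e2
          injection e2 with e2 e3
          subst e1 e2 e3
          exact U1 _ _ _ h1 hv
      · injection e with e1 e2
        have := ne_sz e2
        simp only [sz] at this
        omega
  · -- v = (s, u)
    rcases hv with ⟨hv, rfl⟩ | ⟨hv, rfl⟩
    · rw [e]; exact D1 _ _
    · injection e with e1 e2
      rcases hu with ⟨hu, rfl⟩ | ⟨hu, rfl⟩
      · subst e2
        exact (irr _ hu).elim
      · have := ne_sz e2
        simp only [sz] at this
        omega
  · -- v = (s, (u, c))
    rcases hv with ⟨hv, rfl⟩ | ⟨hv, rfl⟩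
    · rw [e]; exact D2 _ _ _ h1 h2
    · injection e with e1 e2
      subst e1
      rcases hu with ⟨hu, rfl⟩ | ⟨hu, rfl⟩
      · subst e2
        have := R_left hu
        subst this
        rcases h1 with ⟨b, rfl⟩ | h1
        · exact D1 _ _
        · exact h1
      · have := ne_sz e2
        simp only [sz] at this
        omega
  · -- u = (s, (v, c))
    rcases hv with ⟨hv, rfl⟩ | ⟨hv, rfl⟩
    · rw [e]; exact U1 _ _ _ h1 h2
    · rcases hu with ⟨hu, rfl⟩ | ⟨hu, rfl⟩
      · subst e
        rw [R_iff] at hu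
        rcases hu with ⟨p, e⟩ | ⟨p, e, -⟩ | ⟨p, c, e, -⟩ | ⟨p, c, e, h1, h2⟩
        · injection e with e1 e2
          have := ne_sz e2
          simp only [sz] at this
          omega
        · have := ne_sz e
          simp only [sz] at this
          omega
        · have := ne_sz e
          simp only [sz] at this
          omega
        · injection e with e1 e2
          injection e2 with e2 e3
          have := ne_sz e2
          simp only [sz] at this
          omega
      · injection e with e1 e2
        have := ne_sz e2
        simp only [sz] at this
        omega

theorem law (x y z : TT) : R x (op (op y z) (op x z)) := by
  have hu := op_cases y z
  have hv := op_cases x z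
  rcases op_cases (op y z) (op x z) with ⟨hw, e⟩ | ⟨hw, e⟩
  · rw [e]
    exact coll x y z _ _ hu hv hw
  · rw [e]
    rcases hv with ⟨hv, ev⟩ | ⟨hv, ev⟩ <;> rw [ev]
    · apply U0
      rintro ⟨e1, rfl⟩
      rcases hu with ⟨hu, eu⟩ | ⟨hu, eu⟩
      · rw [eu] at e1
        subst e1
        exact no_common z hu hv
      · rw [eu] at e1
        cases e1
    · apply U1 _ _ _ _ hv
      rcases hu with ⟨hu, eu⟩ | ⟨hu, eu⟩ <;> rw [eu]
      · exact Or.inr hu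
      · exact Or.inl ⟨_, rfl⟩

theorem not_gh : ¬ R g h := by
  rw [R_iff]; simp

theorem not_hgh : ¬ R h (n g h) := by
  rw [R_iff]; simp

theorem fails : op g h ≠ op g (op h (op g h)) := by
  have e1 : op g h = n g h := if_neg not_gh
  have e2 : op h (n g h) = n h (n g h) := if_neg not_hgh
  rw [e1, e2]
  rcases op_cases g (n h (n g h)) with ⟨_, e⟩ | ⟨_, e⟩ <;> rw [e] <;> simp

end TT

/-- There exists a magma satisfying Equation854
(`∀ x y z, x = x ⋄ ((y ⋄ z) ⋄ (x ⋄ z))`) but not Equation3316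
(`∀ x y, x ⋄ y = x ⋄ (y ⋄ (x ⋄ y))`). -/
theorem Equation854_not_implies_Equation3316 :
    ∃ (M : Type) (op : M → M → M),
      (∀ x y z : M, x = op x (op (op y z) (op x z))) ∧
      ¬ (∀ x y : M, op x y = op x (op y (op x y))) := by
  refine ⟨TT, TT.op, fun x y z => ?_, fun hh => TT.fails (hh _ _)⟩
  exact (if_pos (TT.law x y z)).symm
end

section
/- The magma with carrier ℤ and operation x ⋄ y = 2x − ⌊y/2⌋ (where ⌊y/2⌋ denotes floor division of the integer y by 2) satisfies Equation1117 but does not satisfy Equation2441. In particular Equation1117 does not imply Equation2441. -/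
/-- The magma operation `x ⋄ y = 2x - ⌊y/2⌋` on ℤ (note that `/` on ℤ here is
division rounding down, since the divisor `2` is positive). -/
def intHalfOp (x y : ℤ) : ℤ := 2 * x - y / 2

/-- The magma `(ℤ, x ⋄ y = 2x - ⌊y/2⌋)` satisfies Equation1117
(`∀ x y z, x = y ⋄ ((y ⋄ (x ⋄ z)) ⋄ z)`) but not Equation2441
(`∀ x, x = (x ⋄ ((x ⋄ x) ⋄ x)) ⋄ x`). In particular Equation1117 does not
imply Equation2441. -/
theorem intHalfOp_Equation1117_not_Equation2441 :
    ((∀ x y z : ℤ, x = intHalfOp y (intHalfOp (intHalfOp y (intHalfOp x z)) z)) ∧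
      ¬ (∀ x : ℤ, x = intHalfOp (intHalfOp x (intHalfOp (intHalfOp x x) x)) x)) ∧
    ∃ (M : Type) (op : M → M → M),
      (∀ x y z : M, x = op y (op (op y (op x z)) z)) ∧
      ¬ (∀ x : M, x = op (op x (op (op x x) x)) x) := by
  have h1 : ∀ x y z : ℤ, x = intHalfOp y (intHalfOp (intHalfOp y (intHalfOp x z)) z) := by
    intro x y z
    unfold intHalfOp
    omega
  have h2 : ¬ (∀ x : ℤ, x = intHalfOp (intHalfOp x (intHalfOp (intHalfOp x x) x)) x) := by
    intro h
    have h' := h 1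
    norm_num [intHalfOp] at h'
  exact ⟨⟨h1, h2⟩, ℤ, intHalfOp, h1, h2⟩
end

section
/- Every finite magma satisfying Equation1117 also satisfies Equation2441. (The law E1117 can be written as L_y R_z L_y R_z x = x, forcing each right translation R_z to be injective and each left translation L_y to be surjective; on a finite carrier these maps are bijections, whence R_z L_y R_z L_y x = x, which yields E2441 on setting x = y = z.) -/
/-- Every finite magma satisfying Equation1117
(`∀ x y z, x = y ⋄ ((y ⋄ (x ⋄ z)) ⋄ z)`) also satisfies Equation2441
(`∀ x, x = (x ⋄ ((x ⋄ x) ⋄ x)) ⋄ x`). -/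
theorem Equation1117_implies_Equation2441_finite (M : Type*) [Finite M]
    (op : M → M → M) (h : ∀ x y z : M, x = op y (op (op y (op x z)) z)) :
    ∀ x : M, x = op (op x (op (op x x) x)) x := by
  intro x
  have hs : Function.Surjective (op x) := fun a => ⟨_, (h a x x).symm⟩
  exact Finite.injective_iff_surjective.mpr hs (h (op x x) x x)
end

section
/- The magma with carrier ℤ and operation x ⋄ y = x − sgn(y − x) (where sgn t equals 1 for t > 0, −1 for t < 0, and 0 for t = 0) satisfies Equation1648 but does not satisfy Equation206. In particular Equation1648 does not imply Equation206. -/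
/-- The magma operation `x ⋄ y = x - sgn (y - x)` on ℤ, where `Int.sign t` is
`1` for `t > 0`, `-1` for `t < 0`, and `0` for `t = 0`. -/
def intSgnOp (x y : ℤ) : ℤ := x - Int.sign (y - x)

/-- The magma `(ℤ, x ⋄ y = x - sgn (y - x))` satisfies Equation1648
(`∀ x y, x = (x ⋄ y) ⋄ ((x ⋄ y) ⋄ y)`) but not Equation206
(`∀ x y, x = (x ⋄ (x ⋄ y)) ⋄ y`). In particular Equation1648 does not imply
Equation206. -/
theorem intSgnOp_Equation1648_not_Equation206 :
    ((∀ x y : ℤ, x = intSgnOp (intSgnOp x y) (intSgnOp (intSgnOp x y) y)) ∧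
      ¬ (∀ x y : ℤ, x = intSgnOp (intSgnOp x (intSgnOp x y)) y)) ∧
    ∃ (M : Type) (op : M → M → M),
      (∀ x y : M, x = op (op x y) (op (op x y) y)) ∧
      ¬ (∀ x y : M, x = op (op x (op x y)) y) := by
  have h1 : ∀ x y : ℤ, x = intSgnOp (intSgnOp x y) (intSgnOp (intSgnOp x y) y) := by
    intro x y
    rcases lt_trichotomy x y with h | h | h
    · have e1 : intSgnOp x y = x - 1 := by
        rw [intSgnOp, Int.sign_eq_one_of_pos (by omega)]
      have e2 : intSgnOp (x - 1) y = x - 2 := by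
        rw [intSgnOp, Int.sign_eq_one_of_pos (by omega)]; omega
      rw [e1, e2, intSgnOp, Int.sign_eq_neg_one_of_neg (by omega)]; omega
    · subst h
      simp [intSgnOp]
    · have e1 : intSgnOp x y = x + 1 := by
        rw [intSgnOp, Int.sign_eq_neg_one_of_neg (by omega)]; omega
      have e2 : intSgnOp (x + 1) y = x + 2 := by
        rw [intSgnOp, Int.sign_eq_neg_one_of_neg (by omega)]; omega
      rw [e1, e2, intSgnOp, Int.sign_eq_one_of_pos (by omega)]; omega
  have h2 : ¬ (∀ x y : ℤ, x = intSgnOp (intSgnOp x (intSgnOp x y)) y) := by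
    intro h
    exact absurd (h 0 1) (by decide)
  exact ⟨⟨h1, h2⟩, ℤ, intSgnOp, h1, h2⟩
end

section
/- For finite magmas, Equation206 and Equation1648 are equivalent: every finite magma satisfying Equation206 satisfies Equation1648, and every finite magma satisfying Equation1648 satisfies Equation206. (In each direction one shows the right translations R_y are injective, hence bijective on a finite carrier, and transports the law along this bijection.) -/
/-- For finite magmas, Equation206 (`∀ x y, x = (x ⋄ (x ⋄ y)) ⋄ y`) and
Equation1648 (`∀ x y, x = (x ⋄ y) ⋄ ((x ⋄ y) ⋄ y)`) are equivalent. -/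
theorem Equation206_iff_Equation1648_finite (M : Type*) [Finite M]
    (op : M → M → M) :
    (∀ x y : M, x = op (op x (op x y)) y) ↔
      (∀ x y : M, x = op (op x y) (op (op x y) y)) := by
  constructor
  · intro h x y
    have hs : Function.Surjective (fun z => op z y) :=
      fun z => ⟨op z (op z y), (h z y).symm⟩
    have hi : Function.Injective (fun z => op z y) := Finite.injective_iff_surjective.mpr hs
    exact hi (h (op x y) y)
  · intro h x y
    have hi : Function.Injective (fun z => op z y) := by
      intro a b hab
      have hab' : op a y = op b y := hab
      rw [h a y, hab', ← h b y]
    obtain ⟨z, hz⟩ := (Finite.injective_iff_surjective.mp hi) x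
    have hz' : op z y = x := hz
    have h1 := h z y
    rw [hz'] at h1
    rw [← h1, hz']
end

section
/- There exists a magma (M, ⋄) satisfying Equation677 but not satisfying Equation255. (Established in the project by a greedy construction; the corresponding implication for finite magmas remains open.) -/
structure PSol where
  R : ℕ → ℕ → ℕ → Prop
  N : ℕ
  bd : ∀ x y z, R x y z → x < N ∧ y < N ∧ z < N
  fn : ∀ x y z w, R x y z → R x y w → z = w
  law : ∀ x y z w v, R y x z → R z y w → R x w v → R y v x
  aux : ∀ a b y z, R b y a → R y a z → R z y b → R b a y

theorem PSol.ext_step (P : PSol) (a b : ℕ) :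
    ∃ Q : PSol, (∀ x y z, P.R x y z → Q.R x y z) ∧ ∃ c, Q.R a b c := by
  by_cases h : ∃ c, P.R a b c
  · exact ⟨P, fun _ _ _ h => h, h⟩
  obtain ⟨R, N, bd, fn, law, aux⟩ := P
  simp only at h ⊢
  push Not at h
  obtain ⟨c, hc⟩ : ∃ c, c = N + a + b + 1 := ⟨_, rfl⟩
  have hca : c ≠ a := by omega
  have hcb : c ≠ b := by omega
  have f1 : ∀ y z, ¬ R c y z := fun y z hr => by have := bd _ _ _ hr; omega
  have f2 : ∀ y z, ¬ R y c z := fun y z hr => by have := bd _ _ _ hr; omega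
  have f3 : ∀ y z, ¬ R y z c := fun y z hr => by have := bd _ _ _ hr; omega
  let S : ℕ → ℕ → ℕ → Prop := fun x y z =>
    R x y z ∨ (x = a ∧ y = b ∧ z = c) ∨ (y = c ∧ z = a ∧ ∃ t, R x a t ∧ R t x b)
  have g1 : ∀ y z, ¬ S c y z := by
    rintro y z (h1 | ⟨h1, h2, h3⟩ | ⟨h1, h2, t, h3, h4⟩)
    · exact f1 _ _ h1
    · exact hca h1
    · exact f1 _ _ h3
  refine ⟨⟨S, c + 1, ?_, ?_, ?_, ?_⟩, fun x y z hr => Or.inl hr, c, Or.inr (Or.inl ⟨rfl, rfl, rfl⟩)⟩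
  · rintro x y z (h1 | ⟨h1, h2, h3⟩ | ⟨h1, h2, t, h3, h4⟩)
    · have := bd _ _ _ h1; omega
    · omega
    · have := bd _ _ _ h3; omega
  · rintro x y z w (h1 | ⟨h1, h2, h3⟩ | ⟨h1, h2, t, h3, h4⟩)
      (k1 | ⟨k1, k2, k3⟩ | ⟨k1, k2, s, k3, k4⟩) <;> grind
  · intro x y z w v h1 h2 h3
    have hx : x ≠ c := fun e => g1 _ _ (e ▸ h3)
    have hz : z ≠ c := fun e => g1 _ _ (e ▸ h2)
    have hy : y ≠ c := fun e => g1 _ _ (e ▸ h1)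
    have h1' : R y x z := by
      rcases h1 with h1 | ⟨_, _, e⟩ | ⟨e, _⟩
      · exact h1
      · exact absurd e hz
      · exact absurd e hx
    rcases h2 with h2 | ⟨rfl, rfl, rfl⟩ | ⟨e, _⟩
    · rcases h3 with h3 | ⟨rfl, rfl, rfl⟩ | ⟨rfl, _⟩
      · exact Or.inl (law _ _ _ _ _ h1' h2 h3)
      · exact Or.inr (Or.inr ⟨rfl, rfl, z, h1', h2⟩)
      · exact absurd h2 (f3 _ _)
    · rcases h3 with h3 | ⟨_, e, _⟩ | ⟨_, rfl, t, h3, h4⟩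
      · exact absurd h3 (f2 _ _)
      · exact absurd e hcb
      · exact Or.inl (aux _ _ _ _ h1' h3 h4)
    · exact absurd e hy
  · intro p q y z h1 h2 h3
    have hp : q ≠ c := fun e => g1 _ _ (e ▸ h1)
    have hy : y ≠ c := fun e => g1 _ _ (e ▸ h2)
    have hz : z ≠ c := fun e => g1 _ _ (e ▸ h3)
    have h3' : R z y q := by
      rcases h3 with h3 | ⟨_, _, e⟩ | ⟨e, _⟩
      · exact h3
      · exact absurd e hp
      · exact absurd e hy
    rcases h1 with h1 | ⟨rfl, rfl, rfl⟩ | ⟨e, _⟩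
    · rcases h2 with h2 | ⟨_, _, e⟩ | ⟨rfl, _⟩
      · exact Or.inl (aux _ _ _ _ h1 h2 h3')
      · exact absurd e hz
      · exact absurd h1 (f3 _ _)
    · rcases h2 with h2 | ⟨_, e, _⟩ | ⟨_, rfl, _⟩
      · exact absurd h2 (f2 _ _)
      · exact absurd e hcb
      · exact absurd h3' (h _)
    · exact absurd e hy

def PSol.seed : PSol where
  R x y z := y = 0 ∧ x < 3 ∧ z = x + 1
  N := 4
  bd := by intros; omega
  fn := by intros; omega
  law := by intros; omega
  aux := by intros; omega

noncomputable def PSol.seq : ℕ → PSol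
  | 0 => PSol.seed
  | n + 1 => (PSol.ext_step (PSol.seq n) n.unpair.1 n.unpair.2).choose

theorem PSol.seq_mono {m n : ℕ} (h : m ≤ n) (x y z : ℕ) (hr : (PSol.seq m).R x y z) :
    (PSol.seq n).R x y z := by
  induction n, h using Nat.le_induction with
  | base => exact hr
  | succ n _ ih =>
    exact (PSol.ext_step (PSol.seq n) n.unpair.1 n.unpair.2).choose_spec.1 _ _ _ ih

theorem PSol.seq_total (a b : ℕ) : ∃ c n, (PSol.seq n).R a b c := by
  obtain ⟨c, hc⟩ := (PSol.ext_step (PSol.seq (Nat.pair a b)) (Nat.pair a b).unpair.1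
    (Nat.pair a b).unpair.2).choose_spec.2
  refine ⟨c, Nat.pair a b + 1, ?_⟩
  have e1 : (Nat.pair a b).unpair.1 = a := by simp
  have e2 : (Nat.pair a b).unpair.2 = b := by simp
  change (PSol.ext_step (PSol.seq (Nat.pair a b)) (Nat.pair a b).unpair.1
    (Nat.pair a b).unpair.2).choose.R a b c
  generalize (PSol.ext_step (PSol.seq (Nat.pair a b)) (Nat.pair a b).unpair.1
    (Nat.pair a b).unpair.2).choose = Q at hc ⊢
  rwa [e1, e2] at hc

/-- There exists a magma satisfying Equation677
(`∀ x y, x = y ⋄ (x ⋄ ((y ⋄ x) ⋄ y))`) but not Equation255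
(`∀ x, x = ((x ⋄ x) ⋄ x) ⋄ x`). -/
theorem Equation677_not_implies_Equation255 :
    ∃ (M : Type) (op : M → M → M),
      (∀ x y : M, x = op y (op x (op (op y x) y))) ∧
      ¬ (∀ x : M, x = op (op (op x x) x) x) := by
  choose op st hop using PSol.seq_total
  have uniq : ∀ n x y z, (PSol.seq n).R x y z → op x y = z := by
    intro n x y z h
    exact (PSol.seq (max n (st x y))).fn x y _ _
      (PSol.seq_mono (le_max_right _ _) _ _ _ (hop x y))
      (PSol.seq_mono (le_max_left _ _) _ _ _ h)
  refine ⟨ℕ, op, ?_, ?_⟩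
  · intro x y
    let n := max (st y x) (max (st (op y x) y) (st x (op (op y x) y)))
    refine (uniq n _ _ _ ((PSol.seq n).law x y _ _ _
      (PSol.seq_mono ?_ _ _ _ (hop y x)) (PSol.seq_mono ?_ _ _ _ (hop (op y x) y))
      (PSol.seq_mono ?_ _ _ _ (hop x (op (op y x) y))))).symm <;> simp [n]
  · intro h
    have h0 := h 0
    have a0 : op 0 0 = 1 := uniq 0 _ _ _ (by simp [PSol.seq, PSol.seed])
    have a1 : op 1 0 = 2 := uniq 0 _ _ _ (by simp [PSol.seq, PSol.seed])
    have a2 : op 2 0 = 3 := uniq 0 _ _ _ (by simp [PSol.seq, PSol.seed])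
    rw [a0, a1, a2] at h0
    omega
end

section
/- There exists a magma (M, ⋄) satisfying Equation1729 but not satisfying Equation817. (The hardest non-implication resolved in the Equational Theories Project, established by a 'squares first' base-model extension construction.) -/
namespace Sq

section abstractE
variable {H N : Type} [Add H] [Zero H]

structure EInv (S : N → H) (K : H → Prop) (V : N → Prop) (E : H → N → N → Prop) : Prop where
  k0 : K 0
  kadd : ∀ a b, K a → K b → K (a + b)
  vS : ∀ x, V x → K (S x)
  e0 : ∀ a x y, E a x y → K a ∧ V x ∧ V y
  e1 : ∀ a x y y', E a x y → E a x y' → y = y'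
  e2 : ∀ a x x' y, E a x y → E a x' y → x = x'
  e3 : ∀ a b x y, E a x y → E b x y → a = b
  e4a : ∀ v r, E (S v) v r → E (S v) r v
  e4b : ∀ v r, E (S v) r v → E (S v) v r
  e4c : ∀ w v r, E 0 w v → E (S w) v r → E (S w) r v
  e4d : ∀ w v r, E 0 w v → E (S w) r v → E (S w) v r
  e5 : ∀ a w v y, E 0 w v → E a v y → ∃ u, E (a + S y) w u ∧ E (S w) u y
  e6 : ∀ a x y, E 0 x y → ¬ E a y x
  e7 : ∀ b b' z y y', E b z y → E b' z y' → b + S y = b' + S y' → b = b'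
  e8 : ∀ z y, E (S y) z y → ∃ x, E 0 x z
  e10 : ∀ w v, E 0 w v → S w ≠ S v
  e11 : ∀ a x, ¬ E a x x

/-- backward step for a generic label -/
def BWE (E : H → N → N → Prop) (a : H) (z y0 : N) (b : H) (p q : N) : Prop :=
  E b p q ∨ (b = a ∧ p = z ∧ q = y0)

theorem BWE_inv {S : N → H} {K K' : H → Prop} {V V' : N → Prop} {E : H → N → N → Prop}
    (h : EInv S K V E) (hS0 : ∀ x, S x ≠ 0)
    (hK : ∀ a, K a → K' a) (hV : ∀ a, V a → V' a)
    (k0 : K' 0) (kadd : ∀ a b, K' a → K' b → K' (a + b)) (vS : ∀ x, V' x → K' (S x))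
    (a : H) (z y0 : N) (ha : K a) (ha0 : a ≠ 0) (hy0 : V y0) (hz : ¬ V z) (hz' : V' z)
    (hSz : ¬ K (S z)) (hsp : a ≠ S y0) (hsp2 : ∀ w, E 0 w y0 → S w ≠ a)
    (hno : ∀ r, ¬ E a r y0) : EInv S K' V' (BWE E a z y0) := by
  obtain ⟨kk0, kkadd, vS0, e0, e1, e2, e3, e4a, e4b, e4c, e4d, e5, e6, e7, e8, e10, e11⟩ := h
  unfold BWE
  refine ⟨k0, kadd, vS, ?_, ?_, ?_, ?_, ?_, ?_, ?_, ?_, ?_, ?_, ?_, ?_, ?_, ?_⟩ <;> clear kadd kkadd k0 vS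
  · grind
  · grind
  · grind
  · grind
  · grind
  · grind
  · grind
  · grind
  · rintro b w v y (h1 | h1) (h2 | h2)
    · obtain ⟨u, h3, h4⟩ := e5 _ _ _ _ h1 h2
      exact ⟨u, Or.inl h3, Or.inl h4⟩
    · grind
    · grind
    · grind
  · grind
  · rintro b b' z y y' (h1 | h1) (h2 | h2) h3
    · exact e7 _ _ _ _ _ h1 h2 h3
    · grind
    · grind
    · grind
  · grind
  · grind
  · grind

/-- forward step for a label of the form `S w`, `w → v0` by `0` -/
def FW2E (E : H → N → N → Prop) (a : H) (v0 y0 : N) (b : H) (p q : N) : Prop :=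
  E b p q ∨ (b = a ∧ p = v0 ∧ q = y0) ∨ (b = a ∧ p = y0 ∧ q = v0)

theorem FW2E_inv {S : N → H} {K K' : H → Prop} {V V' : N → Prop} {E : H → N → N → Prop}
    (h : EInv S K V E) (hS0 : ∀ x, S x ≠ 0) (hh : ∀ a : H, a + a = 0)
    (hK : ∀ a, K a → K' a) (hV : ∀ a, V a → V' a)
    (k0 : K' 0) (kadd : ∀ a b, K' a → K' b → K' (a + b)) (vS : ∀ x, V' x → K' (S x))
    (a : H) (v0 y0 w0 : N) (hw : E 0 w0 v0) (hwa : S w0 = a) (hy0 : ¬ V y0) (hy' : V' y0)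
    (hSy : S y0 = a)
    (hno : ∀ r, ¬ E a v0 r) : EInv S K' V' (FW2E E a v0 y0) := by
  obtain ⟨kk0, kkadd, vS0, e0, e1, e2, e3, e4a, e4b, e4c, e4d, e5, e6, e7, e8, e10, e11⟩ := h
  have hno' : ∀ r, ¬ E a r v0 := by grind
  have ha0 : a ≠ 0 := by grind
  have hav : a ≠ S v0 := by grind
  have hVv := e0 _ _ _ hw
  have key : ∀ b y, E b v0 y → b + S y ≠ 0 := by
    intro b y hb hc
    obtain ⟨u, h3, h4⟩ := e5 _ _ _ _ hw hb
    grind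
  unfold FW2E
  refine ⟨k0, kadd, vS, ?_, ?_, ?_, ?_, ?_, ?_, ?_, ?_, ?_, ?_, ?_, ?_, ?_, ?_⟩ <;> clear kadd kkadd k0 vS
  · grind
  · rintro b p q q' (h1 | h1 | h1) (h3 | h3 | h3) <;> grind
  · rintro b p q q' (h1 | h1 | h1) (h3 | h3 | h3) <;> grind
  · grind
  · grind
  · grind
  · rintro w v r (h1 | h1 | h1) (h3 | h3 | h3)
    · exact Or.inl (e4c _ _ _ h1 h3)
    all_goals grind
  · rintro w v r (h1 | h1 | h1) (h3 | h3 | h3)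
    · exact Or.inl (e4d _ _ _ h1 h3)
    all_goals grind
  · rintro b w v y (h1 | h1 | h1) (h2 | h2 | h2)
    · obtain ⟨u, h3, h4⟩ := e5 _ _ _ _ h1 h2
      exact ⟨u, Or.inl h3, Or.inl h4⟩
    · obtain ⟨rfl, rfl, rfl⟩ := h2
      have : w = w0 := e2 _ _ _ _ h1 hw
      subst this
      exact ⟨v, Or.inl (by rw [hSy, hh]; exact hw), Or.inr (Or.inl ⟨hwa, rfl, rfl⟩)⟩
    all_goals grind
  · grind
  · rintro b b' z y y' (h1 | h1 | h1) (h2 | h2 | h2) h3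
    · exact e7 _ _ _ _ _ h1 h2 h3
    all_goals grind
  · grind
  · grind
  · grind

/-- backward step for the label `0` -/
def BW0E (S : N → H) (E : H → N → N → Prop) (z x : N) (u : H → N) (b : H) (p q : N) : Prop :=
  E b p q ∨ (b = 0 ∧ p = x ∧ q = z) ∨
  (∃ b' y, E b' z y ∧ b = b' + S y ∧ p = x ∧ q = u b') ∨
  (∃ b' y, E b' z y ∧ b = S x ∧ p = u b' ∧ q = y)

set_option maxHeartbeats 1000000 in
theorem BW0E_inv {S : N → H} {K K' : H → Prop} {V V' : N → Prop} {E : H → N → N → Prop}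
    (h : EInv S K V E) (hS0 : ∀ x, S x ≠ 0) (hh : ∀ a : H, a + a = 0)
    (hK : ∀ a, K a → K' a) (hV : ∀ a, V a → V' a)
    (k0 : K' 0) (kadd : ∀ a b, K' a → K' b → K' (a + b)) (vS : ∀ x, V' x → K' (S x))
    (z x : N) (u : H → N) (hz : V z) (hx : ¬ V x) (hx' : V' x) (hu : ∀ b, ¬ V (u b))
    (hu' : ∀ b, V' (u b)) (hux : ∀ b, u b ≠ x) (uinj : ∀ b b', u b = u b' → b = b')
    (hSx : ¬ K (S x)) (d : H) (hSu : ∀ b, S (u b) = d) (hd : ¬ K d) (hdx : d ≠ S x)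
    (hcan : ∀ a b : H, a + b = 0 → a = b)
    (hKc : ∀ a b, K a → K (a + b) → K b) (hcr : ∀ a b c : H, a + c = b + c → a = b)
    (hno : ∀ r, ¬ E 0 r z) : EInv S K' V' (BW0E S E z x u) := by
  obtain ⟨kk0, kkadd, vS0, e0, e1, e2, e3, e4a, e4b, e4c, e4d, e5, e6, e7, e8, e10, e11⟩ := h
  have hbS : ∀ b y, E b z y → b ≠ S y := by
    rintro b y h1 rfl
    obtain ⟨r, hr⟩ := e8 _ _ h1
    exact hno _ hr
  have hbS' : ∀ b y, E b z y → b + S y ≠ 0 := by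
    intro b y h1 h3
    exact hbS b y h1 (hcan _ _ h3)
  have hbK : ∀ b y, E b z y → K (b + S y) := fun b y h1 =>
    kkadd _ _ (e0 _ _ _ h1).1 (vS0 _ (e0 _ _ _ h1).2.2)
  have hKx := vS x hx'
  have hz0 : K (0 + S z) := kkadd _ _ kk0 (vS0 _ hz)
  have hKd : ∀ b, K b → ¬ K (b + d) := fun b h1 h3 => hd (hKc _ _ h1 h3)
  unfold BW0E
  refine ⟨k0, kadd, vS, ?_, ?_, ?_, ?_, ?_, ?_, ?_, ?_, ?_, ?_, ?_, ?_, ?_, ?_⟩ <;> clear kadd kkadd k0 vS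
  · rintro b p q (h1 | h1 | ⟨b', y, h1, h1'⟩ | ⟨b', y, h1, h1'⟩) <;> grind
  · rintro b p q q' (h1 | h1 | ⟨b', y, h1, h1'⟩ | ⟨b', y, h1, h1'⟩) (h3 | h3 | ⟨b3, y3, h3, h3'⟩ | ⟨b3, y3, h3, h3'⟩) <;> grind
  · rintro b p q q' (h1 | h1 | ⟨b', y, h1, h1'⟩ | ⟨b', y, h1, h1'⟩) (h3 | h3 | ⟨b3, y3, h3, h3'⟩ | ⟨b3, y3, h3, h3'⟩) <;> grind
  · rintro b p q q' (h1 | h1 | ⟨b', y, h1, h1'⟩ | ⟨b', y, h1, h1'⟩) (h3 | h3 | ⟨b3, y3, h3, h3'⟩ | ⟨b3, y3, h3, h3'⟩) <;> grind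
  · rintro v r (h1 | h1 | ⟨b', y, h1, h1'⟩ | ⟨b', y, h1, h1'⟩) <;> grind
  · rintro v r (h1 | h1 | ⟨b', y, h1, h1'⟩ | ⟨b', y, h1, h1'⟩) <;> grind
  · rintro b p q (h1 | h1 | ⟨b', y, h1, h1'⟩ | ⟨b', y, h1, h1'⟩) (h3 | h3 | ⟨b3, y3, h3, h3'⟩ | ⟨b3, y3, h3, h3'⟩) <;> grind
  · rintro b p q (h1 | h1 | ⟨b', y, h1, h1'⟩ | ⟨b', y, h1, h1'⟩) (h3 | h3 | ⟨b3, y3, h3, h3'⟩ | ⟨b3, y3, h3, h3'⟩) <;> grind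
  · rintro b w v y (h1 | h1 | ⟨b', y', h1, h1'⟩ | ⟨b', y', h1, h1'⟩) (h3 | h3 | ⟨b3, y3, h3, h3'⟩ | ⟨b3, y3, h3, h3'⟩)
    · obtain ⟨u, h3, h4⟩ := e5 _ _ _ _ h1 h3
      exact ⟨u, Or.inl h3, Or.inl h4⟩
    all_goals first | (exfalso; grind) | skip
    obtain ⟨_, rfl, rfl⟩ := h1
    exact ⟨u b, Or.inr (Or.inr (Or.inl ⟨b, y, h3, rfl, rfl, rfl⟩)),
      Or.inr (Or.inr (Or.inr ⟨b, y, h3, rfl, rfl, rfl⟩))⟩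
  · rintro b p q (h1 | h1 | ⟨b', y, h1, h1'⟩ | ⟨b', y, h1, h1'⟩) (h3 | h3 | ⟨b3, y3, h3, h3'⟩ | ⟨b3, y3, h3, h3'⟩) <;> grind
  · rintro b p q q1 q2 (h1 | h1 | ⟨b', y, h1, h1'⟩ | ⟨b', y, h1, h1'⟩) (h3 | h3 | ⟨b3, y3, h3, h3'⟩ | ⟨b3, y3, h3, h3'⟩) h5
    · exact e7 _ _ _ _ _ h1 h3 h5
    all_goals grind
  · rintro v r (h1 | h1 | ⟨b', y, h1, h1'⟩ | ⟨b', y, h1, h1'⟩)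
    · obtain ⟨x, hx⟩ := e8 _ _ h1
      exact ⟨x, Or.inl hx⟩
    all_goals grind
  · rintro v r (h1 | h1 | ⟨b', y, h1, h1'⟩ | ⟨b', y, h1, h1'⟩) <;> grind
  · rintro v r (h1 | h1 | ⟨b', y, h1, h1'⟩ | ⟨b', y, h1, h1'⟩) <;> grind

end abstractE

section abstractF
variable {H N : Type} [Add H] [Zero H]

/-- forward step -/
inductive FWE (S : N → H) (V : N → Prop) (E : H → N → N → Prop) (a : H) (v0 xx : N)
    (c : ℕ → H) (u : ℕ → N → N) : H → N → N → Prop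
  | old (b p q) : E b p q → FWE S V E a v0 xx c u b p q
  | t1 (i v) : V v → (i = 0 → v = v0) → FWE S V E a v0 xx c u (c i) v (u i v)
  | t2 (i w v) : E 0 w v → (i = 0 → v = v0) → FWE S V E a v0 xx c u (S w) (u (i+1) w) (u i v)
  | t3 : a = S v0 → FWE S V E a v0 xx c u a (u 0 v0) v0
  | t4 : a = S v0 → FWE S V E a v0 xx c u 0 xx (u 0 v0)

theorem FWE_cases {S : N → H} {V : N → Prop} {E : H → N → N → Prop} {a : H} {v0 xx : N}
    {c : ℕ → H} {u : ℕ → N → N} {b : H} {p q : N} (h : FWE S V E a v0 xx c u b p q) :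
    E b p q ∨ (∃ i, V p ∧ (i = 0 → p = v0) ∧ b = c i ∧ q = u i p) ∨
    (∃ i w v, E 0 w v ∧ (i = 0 → v = v0) ∧ b = S w ∧ p = u (i+1) w ∧ q = u i v) ∨
    (a = S v0 ∧ b = a ∧ p = u 0 v0 ∧ q = v0) ∨ (a = S v0 ∧ b = 0 ∧ p = xx ∧ q = u 0 v0) := by
  cases h <;> grind

set_option maxHeartbeats 2000000 in
theorem FWE_inv {S : N → H} {K K' : H → Prop} {V V' : N → Prop} {E : H → N → N → Prop}
    (h : EInv S K V E) (hS0 : ∀ x, S x ≠ 0) (hh : ∀ a : H, a + a = 0)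
    (hK : ∀ a, K a → K' a) (hV : ∀ a, V a → V' a)
    (k0 : K' 0) (kadd : ∀ a b, K' a → K' b → K' (a + b)) (vS : ∀ x, V' x → K' (S x))
    (a : H) (v0 xx : N) (c : ℕ → H) (u : ℕ → N → N) (ha : K a) (hv0 : V v0)
    (hno : ∀ r, ¬ E a v0 r) (hno2 : ∀ w, E 0 w v0 → S w ≠ a)
    (hc0 : c 0 = a) (hc1 : ∀ i, ¬ K (c (i+1))) (hcinj : ∀ i j, c (i+1) = c (j+1) → i = j)
    (hcK : ∀ i, K' (c i))
    (hu : ∀ i v, ¬ V (u i v)) (hu' : ∀ i v, V v → V' (u i v))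
    (uinj : ∀ i j v w, V v → V w → u i v = u j w → i = j ∧ v = w)
    (hSu : ∀ i v, ¬ K (S (u i v))) (hSuc : ∀ i v, S (u i v) ≠ c i)
    (hcS : ∀ i v, c i + S (u i v) = c (i+1)) (hx : ¬ V xx) (hx' : V' xx)
    (hxu : ∀ i v, u i v ≠ xx) (hSx : a = S v0 → S xx = a) :
    EInv S K' V' (FWE S V E a v0 xx c u) := by
  obtain ⟨kk0, kkadd, vS0, e0, e1, e2, e3, e4a, e4b, e4c, e4d, e5, e6, e7, e8, e10, e11⟩ := h
  have hno' : a = S v0 → ∀ r, ¬ E a r v0 := by grind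
  have hSw : ∀ w v, E 0 w v → K (S w) := fun w v h1 => vS0 _ (e0 _ _ _ h1).2.1
  have hci : ∀ i, K (c i) → i = 0 := by
    intro i; cases i with
    | zero => simp
    | succ i => intro h1; exact (hc1 i h1).elim
  have hcinj' : ∀ i j, c i = c j → i = j := by
    intro i j; cases i <;> cases j <;> grind
  have hbK : ∀ b x y, E b x y → K (b + S y) := fun b x y h1 =>
    kkadd _ _ (e0 _ _ _ h1).1 (vS0 _ (e0 _ _ _ h1).2.2)
  have hKx := vS xx hx'
  refine ⟨k0, kadd, vS, ?_, ?_, ?_, ?_, ?_, ?_, ?_, ?_, ?_, ?_, ?_, ?_, ?_, ?_⟩ <;> clear kadd kkadd k0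
  · intro b p q h1
    rcases h1 with h1 | ⟨i, v, h1, h1'⟩ | ⟨i, w, v, h1, h1'⟩ | _ | _ <;> grind
  · intro b p q q' h1 h3
    rcases FWE_cases h1 with h1 | ⟨i, h1, h1'⟩ | ⟨i, w, v, h1, h1'⟩ | h1 | h1 <;>
    rcases FWE_cases h3 with h3 | ⟨j, h3, h3'⟩ | ⟨j, w', v', h3, h3'⟩ | h3 | h3 <;> grind
  · intro b p q q' h1 h3
    rcases FWE_cases h1 with h1 | ⟨i, h1, h1'⟩ | ⟨i, w, v, h1, h1'⟩ | h1 | h1 <;>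
    rcases FWE_cases h3 with h3 | ⟨j, h3, h3'⟩ | ⟨j, w', v', h3, h3'⟩ | h3 | h3 <;> grind
  · intro b p q q' h1 h3
    rcases FWE_cases h1 with h1 | ⟨i, h1, h1'⟩ | ⟨i, w, v, h1, h1'⟩ | h1 | h1 <;>
    rcases FWE_cases h3 with h3 | ⟨j, h3, h3'⟩ | ⟨j, w', v', h3, h3'⟩ | h3 | h3 <;> grind
  · intro v r h1
    rcases FWE_cases h1 with h1 | ⟨i, h1, h1'⟩ | ⟨i, w, v, h1, h1'⟩ | h1 | h1
    · exact FWE.old _ _ _ (e4a _ _ h1)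
    · have : i = 0 := by grind
      have : v = v0 := by grind
      have : FWE S V E a v0 xx c u a (u 0 v0) v0 := FWE.t3 (by grind)
      grind
    all_goals grind
  · intro v r h1
    rcases FWE_cases h1 with h1 | ⟨i, h1, h1'⟩ | ⟨i, w, v, h1, h1'⟩ | h1 | h1
    · exact FWE.old _ _ _ (e4b _ _ h1)
    · grind
    · grind
    · have : FWE S V E a v0 xx c u (c 0) v0 (u 0 v0) := FWE.t1 _ _ hv0 (by grind)
      grind
    · grind
  · intro w v r h1 h3
    rcases FWE_cases h1 with h1 | ⟨i, h1, h1'⟩ | ⟨i, w', v', h1, h1'⟩ | h1 | h1 <;>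
    rcases FWE_cases h3 with h3 | ⟨j, h3, h3'⟩ | ⟨j, w'', v'', h3, h3'⟩ | h3 | h3
    · exact FWE.old _ _ _ (e4c _ _ _ h1 h3)
    all_goals first | (exfalso; grind; done) | skip
    have : FWE S V E a v0 xx c u (c 0) v0 (u 0 v0) := FWE.t1 _ _ hv0 (by grind)
    grind
  · intro w v r h1 h3
    rcases FWE_cases h1 with h1 | ⟨i, h1, h1'⟩ | ⟨i, w', v', h1, h1'⟩ | h1 | h1 <;>
    rcases FWE_cases h3 with h3 | ⟨j, h3, h3'⟩ | ⟨j, w'', v'', h3, h3'⟩ | h3 | h3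
    · exact FWE.old _ _ _ (e4d _ _ _ h1 h3)
    all_goals first | (exfalso; grind; done) | skip
    have : FWE S V E a v0 xx c u a (u 0 v0) v0 := FWE.t3 (by grind)
    grind
  · intro b w v y h1 h3
    rcases FWE_cases h1 with h1 | ⟨i, h1, h1'⟩ | ⟨i, w', v', h1, h1'⟩ | h1 | h1 <;>
    rcases FWE_cases h3 with h3 | ⟨j, h3, h3'⟩ | ⟨j, w'', v'', h3, h3'⟩ | h3 | h3
    · obtain ⟨u, h3, h4⟩ := e5 _ _ _ _ h1 h3
      exact ⟨u, FWE.old _ _ _ h3, FWE.old _ _ _ h4⟩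
    all_goals first | (exfalso; grind; done) | skip
    · obtain ⟨h4, rfl, rfl⟩ := h3'
      refine ⟨u (j+1) w, ?_, FWE.t2 _ _ _ h1 h4⟩
      rw [hcS]
      exact FWE.t1 _ _ (e0 _ _ _ h1).2.1 (by grind)
    · obtain ⟨h4, rfl, h5, h6⟩ := h3
      obtain ⟨-, -, rfl, rfl⟩ := h1
      subst h6
      refine ⟨u 0 y, ?_, ?_⟩
      · rw [← h4, hh]; exact FWE.t4 h4
      · rw [hSx h4]; exact FWE.t3 h4
  · intro b p q h1 h3
    rcases FWE_cases h1 with h1 | ⟨i, h1, h1'⟩ | ⟨i, w, v, h1, h1'⟩ | h1 | h1 <;>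
    rcases FWE_cases h3 with h3 | ⟨j, h3, h3'⟩ | ⟨j, w', v', h3, h3'⟩ | h3 | h3 <;> grind
  · intro b b' p q q' h1 h3 h5
    rcases FWE_cases h1 with h1 | ⟨i, h1, h1'⟩ | ⟨i, w, v, h1, h1'⟩ | h1 | h1 <;>
    rcases FWE_cases h3 with h3 | ⟨j, h3, h3'⟩ | ⟨j, w', v', h3, h3'⟩ | h3 | h3
    · exact e7 _ _ _ _ _ h1 h3 h5
    all_goals grind
  · intro v r h1
    rcases FWE_cases h1 with h1 | ⟨i, h1, h1'⟩ | ⟨i, w, v, h1, h1'⟩ | h1 | h1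
    · obtain ⟨x, hx⟩ := e8 _ _ h1
      exact ⟨x, FWE.old _ _ _ hx⟩
    · grind
    · grind
    · exact ⟨xx, by obtain ⟨h4, -, rfl, -⟩ := h1; exact FWE.t4 h4⟩
    · grind
  · intro v r h1
    rcases FWE_cases h1 with h1 | ⟨i, h1, h1'⟩ | ⟨i, w, v, h1, h1'⟩ | h1 | h1 <;> grind
  · intro v r h1
    rcases FWE_cases h1 with h1 | ⟨i, h1, h1'⟩ | ⟨i, w, v, h1, h1'⟩ | h1 | h1 <;> grind

end abstractF

section abstractP
variable {H N : Type} [Add H] [Zero H]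

def Spec (S : N → H) (E : H → N → N → Prop) (v : N) (a : H) : Prop :=
  a = S v ∨ ∃ w, E 0 w v ∧ S w = a

def sp (E : H → N → N → Prop) (y x : N) : Prop := ∃ v b, E 0 y v ∧ E b v x

structure PInv (S : N → H) (V : N → Prop) (E : H → N → N → Prop) (P : N → N → N → Prop) :
    Prop where
  p0 : ∀ x y z, P x y z → V x ∧ V y ∧ V z
  p1 : ∀ x y z z', P x y z → P x y z' → z = z'
  p2 : ∀ x y z r, P y x z → E (S y) r x → P z y r
  p3 : ∀ x y z r, P y x z → P z y r → E (S y) r x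
  p4 : ∀ x y z, P y x z → y ≠ x ∧ ¬ sp E y x
  p5 : ∀ x y z, P y x z → z ≠ y ∧ ¬ sp E z y
  p6 : ∀ x x0 x1 y, P x x0 y → P x x1 y → x0 = x1
  p7 : ∀ x x' x0 y, P x x0 y → P x' x0 y → S x = S x' → x = x'
  p8 : ∀ x x' x0 y y' r, P x x0 y → P x' x0 y' → S x = S x' → E (S y) r x → E (S y') r x' → x = x'
  p9 : ∀ x y z, P y x z → Spec S E x (S y) → ∃ r, E (S y) r x
  p9b : ∀ x x0 y, P x x0 y → ¬ Spec S E x (S y)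

theorem PInv_mono {S : N → H} {V V' : N → Prop} {E E' : H → N → N → Prop} {P : N → N → N → Prop}
    (h : PInv S V E P) (hV : ∀ a, V a → V' a) (hE : ∀ a x y, E a x y → E' a x y)
    (hA : ∀ x y z r, P y x z → E' (S y) r x → E (S y) r x)
    (hA' : ∀ x y z r, P x z y → E' (S y) r x → E (S y) r x)
    (hB : ∀ x y, V x → V y → sp E' y x → sp E y x)
    (hC : ∀ x y, V x → V y → Spec S E' x (S y) → Spec S E x (S y)) : PInv S V' E' P := by
  obtain ⟨p0, p1, p2, p3, p4, p5, p6, p7, p8, p9, p9b⟩ := h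
  refine ⟨?_, p1, ?_, ?_, ?_, ?_, p6, p7, ?_, ?_, ?_⟩ <;> grind

theorem FW_P {S : N → H} {K : H → Prop} {V V' : N → Prop} {E : H → N → N → Prop}
    {P : N → N → N → Prop} (h : EInv S K V E) (hP : PInv S V E P) (hS0 : ∀ x, S x ≠ 0)
    (hV : ∀ a, V a → V' a)
    (a : H) (v0 xx : N) (c : ℕ → H) (u : ℕ → N → N)
    (hno : ∀ r, ¬ E a v0 r) 
    (hu : ∀ i v, ¬ V (u i v)) (hx : ¬ V xx) 
    (hxu : ∀ i v, u i v ≠ xx) (hv0 : V v0) (hc0 : c 0 = a)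
    (hci : ∀ i, c (i+1) ≠ 0) (uinj : ∀ i j v w, V v → V w → u i v = u j w → i = j ∧ v = w) :
    PInv S V' (FWE S V E a v0 xx c u) P := by
  obtain ⟨kk0, kkadd, vS0, e0, e1, e2, e3, e4a, e4b, e4c, e4d, e5, e6, e7, e8, e10, e11⟩ := h
  clear kk0 kkadd vS0 e5 e7 e10 e11
  have hP' := hP
  obtain ⟨p0, p1, p2, p3, p4, p5, p6, p7, p8, p9, p9b⟩ := hP
  apply PInv_mono hP' hV (fun a x y => FWE.old a x y)
  · intro x y z r h1 h3
    rcases FWE_cases h3 with h3 | ⟨j, h3, h3'⟩ | ⟨j, w', v', h3, h3'⟩ | h3 | h3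
    · exact h3
    · grind
    · grind
    · obtain ⟨r, hr⟩ := p9 _ _ _ h1 (Or.inl (by grind))
      grind
    · grind
  · intro x y z r h1 h3
    rcases FWE_cases h3 with h3 | ⟨j, h3, h3'⟩ | ⟨j, w', v', h3, h3'⟩ | h3 | h3
    · exact h3
    · grind
    · grind
    · exact (p9b _ _ _ h1 (Or.inl (by grind))).elim
    · grind
  · rintro x y hx1 hy1 ⟨v, b, h1, h3⟩
    rcases FWE_cases h1 with h1 | ⟨i, h1, h1'⟩ | ⟨i, w', v', h1, h1'⟩ | h1 | h1 <;>
    rcases FWE_cases h3 with h3 | ⟨j, h3, h3'⟩ | ⟨j, w', v', h3, h3'⟩ | h3 | h3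
    · exact ⟨v, b, h1, h3⟩
    all_goals first | grind | (cases i <;> grind)
  · rintro x y hx1 hy1 (h1 | ⟨w, h1, h3⟩)
    · exact Or.inl h1
    · rcases FWE_cases h1 with h1 | ⟨i, h1, h1'⟩ | ⟨i, w', v', h1, h1'⟩ | h1 | h1
      · exact Or.inr ⟨w, h1, h3⟩
      all_goals grind

theorem FW2_P {S : N → H} {K : H → Prop} {V V' : N → Prop} {E : H → N → N → Prop}
    {P : N → N → N → Prop} (h : EInv S K V E) (hP : PInv S V E P) (hS0 : ∀ x, S x ≠ 0)
    (hV : ∀ a, V a → V' a)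
    (a : H) (v0 y0 w0 : N) (hw : E 0 w0 v0) (hwa : S w0 = a) (hy0 : ¬ V y0)
    (hno : ∀ r, ¬ E a v0 r) : PInv S V' (FW2E E a v0 y0) P := by
  obtain ⟨kk0, kkadd, vS0, e0, e1, e2, e3, e4a, e4b, e4c, e4d, e5, e6, e7, e8, e10, e11⟩ := h
  clear kk0 kkadd vS0 e5 e7 e10 e11
  have hP' := hP
  obtain ⟨p0, p1, p2, p3, p4, p5, p6, p7, p8, p9, p9b⟩ := hP
  have hno' : ∀ r, ¬ E a r v0 := by grind
  have ha0 : a ≠ 0 := by grind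
  apply PInv_mono hP' hV (fun a x y => Or.inl)
  · rintro x y z r h1 (h3 | h3 | h3)
    · exact h3
    · grind
    · obtain ⟨r, hr⟩ := p9 _ _ _ h1 (Or.inr ⟨w0, by grind, by grind⟩)
      grind
  · rintro x y z r h1 (h3 | h3 | h3)
    · exact h3
    · grind
    · exact (p9b _ _ _ h1 (Or.inr ⟨w0, by grind, by grind⟩)).elim
  · rintro x y hx1 hy1 ⟨v, b, h1 | h1 | h1, h3 | h3 | h3⟩
    · exact ⟨v, b, h1, h3⟩
    all_goals grind
  · rintro x y hx1 hy1 (h1 | ⟨w, h1 | h1 | h1, h3⟩)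
    · exact Or.inl h1
    · exact Or.inr ⟨w, h1, h3⟩
    all_goals grind

theorem BW0_P {S : N → H} {K : H → Prop} {V V' : N → Prop} {E : H → N → N → Prop}
    {P : N → N → N → Prop} (h : EInv S K V E) (hP : PInv S V E P) (hS0 : ∀ x, S x ≠ 0)
    (hV : ∀ a, V a → V' a)
    (z x : N) (u : H → N) (hz : V z) (hx : ¬ V x) (hu : ∀ b, ¬ V (u b))
    (hux : ∀ b, u b ≠ x) 
    (hSx : ¬ K (S x)) :
    PInv S V' (BW0E S E z x u) P := by
  obtain ⟨kk0, kkadd, vS0, e0, e1, e2, e3, e4a, e4b, e4c, e4d, e5, e6, e7, e8, e10, e11⟩ := h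
  clear kk0 kkadd e5 e7 e10 e11
  have hP' := hP
  obtain ⟨p0, p1, p2, p3, p4, p5, p6, p7, p8, p9, p9b⟩ := hP
  apply PInv_mono hP' hV (fun a x y => Or.inl)
  · rintro x y z r h1 (h3 | h3 | ⟨b3, y3, h3, h3'⟩ | ⟨b3, y3, h3, h3'⟩)
    · exact h3
    all_goals grind
  · rintro x y z r h1 (h3 | h3 | ⟨b3, y3, h3, h3'⟩ | ⟨b3, y3, h3, h3'⟩)
    · exact h3
    all_goals grind
  · rintro x y hx1 hy1 ⟨v, b, h1 | h1 | ⟨b', y', h1, h1'⟩ | ⟨b', y', h1, h1'⟩, h3 | h3 | ⟨b3, y3, h3, h3'⟩ | ⟨b3, y3, h3, h3'⟩⟩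
    · exact ⟨v, b, h1, h3⟩
    all_goals grind
  · rintro x y hx1 hy1 (h1 | ⟨w, h1 | h1 | ⟨b', y', h1, h1'⟩ | ⟨b', y', h1, h1'⟩, h3⟩)
    · exact Or.inl h1
    · exact Or.inr ⟨w, h1, h3⟩
    all_goals grind

/-- new products for the generic backward step -/
def BWP (S : N → H) (E : H → N → N → Prop) (P : N → N → N → Prop) (a : H) (z y0 : N)
    (p q r : N) : Prop :=
  P p q r ∨ (S q = a ∧ P q y0 p ∧ r = z) ∨ (p = z ∧ ∃ x, S x = a ∧ P x y0 q ∧ E (S q) r x)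

set_option maxHeartbeats 2000000 in
theorem BW_P {S : N → H} {K : H → Prop} {V V' : N → Prop} {E : H → N → N → Prop}
    {P : N → N → N → Prop} (h : EInv S K V E) (hP : PInv S V E P)
    (hV : ∀ a, V a → V' a) 
    (a : H) (z y0 : N) (ha : K a) (ha0 : a ≠ 0) (hz : ¬ V z) (hz' : V' z)
    (hSz : ¬ K (S z)) (hsp : a ≠ S y0)
    (hno : ∀ r, ¬ E a r y0) : PInv S V' (BWE E a z y0) (BWP S E P a z y0) := by
  obtain ⟨kk0, kkadd, vS0, e0, e1, e2, e3, e4a, e4b, e4c, e4d, e5, e6, e7, e8, e10, e11⟩ := h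
  obtain ⟨p0, p1, p2, p3, p4, p5, p6, p7, p8, p9, p9b⟩ := hP
  clear kk0 kkadd e5 e7 e10 e11 e3 e4a e4b e4c e4d e6 e8
  have hsp' : ∀ y x, sp (BWE E a z y0) y x → sp E y x := by
    rintro y x ⟨v, b, h1 | h1, h3 | h3⟩
    · exact ⟨v, b, h1, h3⟩
    all_goals grind
  have hSpec' : ∀ y x, Spec S (BWE E a z y0) y x → Spec S E y x := by
    rintro y x (h1 | ⟨w, h1 | h1, h3⟩)
    · exact Or.inl h1
    · exact Or.inr ⟨w, h1, h3⟩
    · grind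
  have hspz : ∀ y, ¬ sp E z y ∧ ¬ sp E y z := by
    intro y; constructor
    · rintro ⟨v, b, h1, h3⟩
      grind
    · rintro ⟨v, b, h1, h3⟩
      grind
  have hSpz : ∀ y, V y → ¬ Spec S E y (S z) ∧ ¬ Spec S E z (S y) := by
    intro y hy; constructor
    · rintro (h1 | ⟨w, h1, h3⟩)
      · grind
      · grind
    · rintro (h1 | ⟨w, h1, h3⟩)
      · grind
      · grind
  refine ⟨?_, ?_, ?_, ?_, ?_, ?_, ?_, ?_, ?_, ?_, ?_⟩
  · rintro x y z (h1 | h1 | ⟨h1, x1, h1'⟩) <;> grind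
  · rintro x y z z' (h1 | h1 | ⟨h1, x1, h1'⟩) (h3 | h3 | ⟨h3, x3, h3'⟩) <;> grind
  · rintro x y z1 r (h1 | h1 | ⟨h1, x1, h1'⟩) (h3 | h3)
    · exact Or.inl (p2 _ _ _ _ h1 h3)
    · exact Or.inr (Or.inl (by grind))
    · exact Or.inr (Or.inr ⟨h1.2.2, x, h1.1, h1.2.1, h3⟩)
    all_goals grind
  · rintro x y z1 r (h1 | h1 | ⟨h1, x1, h1'⟩) (h3 | h3 | ⟨h3, x3, h3'⟩)
    · exact Or.inl (p3 _ _ _ _ h1 h3)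
    · exact Or.inr (by grind)
    all_goals first | (exfalso; grind; done) | skip
    exact Or.inl (by grind)
  · rintro x y z1 (h1 | h1 | ⟨h1, x1, h1'⟩) <;> grind
  · rintro x y z1 (h1 | h1 | ⟨h1, x1, h1'⟩) <;> grind
  · rintro x y z1 r (h1 | h1 | ⟨h1, x1, h1'⟩) (h3 | h3 | ⟨h3, x3, h3'⟩) <;> grind
  · rintro x y z1 r (h1 | h1 | ⟨h1, x1, h1'⟩) (h3 | h3 | ⟨h3, x3, h3'⟩) <;> grind
  · rintro x x' x0 y y' r (h1 | h1 | ⟨h1, x1, h1'⟩) (h3 | h3 | ⟨h3, x3, h3'⟩) h5 (h6 | h6) (h7 | h7) <;> grind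
  · rintro x y z1 (h1 | h1 | ⟨h1, x1, h1'⟩) h3
    · obtain ⟨r, hr⟩ := p9 _ _ _ h1 (hSpec' _ _ h3)
      exact ⟨r, Or.inl hr⟩
    · grind
    · grind
  · rintro x y z1 (h1 | h1 | ⟨h1, x1, h1'⟩) h3 <;> grind

/-- new product -/
def ADDP (S : N → H) (E : H → N → N → Prop) (P : N → N → N → Prop) (z y0 x0 : N)
    (p q r : N) : Prop :=
  P p q r ∨ (p = y0 ∧ q = x0 ∧ r = z) ∨ (p = z ∧ q = y0 ∧ E (S y0) r x0)

set_option maxHeartbeats 2000000 in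
theorem ADD_P {S : N → H} {K : H → Prop} {V V' : N → Prop} {E : H → N → N → Prop}
    {P : N → N → N → Prop} (h : EInv S K V E) (hP : PInv S V E P)
    (hV : ∀ a, V a → V' a) 
    (z y0 x0 : N) (hy0 : V y0) (hx0 : V x0) (hz : ¬ V z) (hz' : V' z)
    (hSz : ¬ K (S z)) (hxy : y0 ≠ x0) (hsp : ¬ sp E y0 x0) (hno : ∀ r, ¬ P y0 x0 r)
    (hno2 : ∀ r, ¬ P x0 r y0) (h9 : Spec S E x0 (S y0) → ∃ r, E (S y0) r x0) :
    PInv S V' E (ADDP S E P z y0 x0) := by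
  obtain ⟨kk0, kkadd, vS0, e0, e1, e2, e3, e4a, e4b, e4c, e4d, e5, e6, e7, e8, e10, e11⟩ := h
  obtain ⟨p0, p1, p2, p3, p4, p5, p6, p7, p8, p9, p9b⟩ := hP
  clear kk0 kkadd e5 e7 e10 e11 e3 e4a e4b e4c e4d e6 e8
  have hspz : ∀ y, ¬ sp E z y ∧ ¬ sp E y z := by
    intro y; constructor
    · rintro ⟨v, b, h1, h3⟩
      grind
    · rintro ⟨v, b, h1, h3⟩
      grind
  have hSpz : ∀ y, V y → ¬ Spec S E y (S z) ∧ ¬ Spec S E z (S y) := by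
    intro y hy; constructor
    · rintro (h1 | ⟨w, h1, h3⟩)
      · grind
      · grind
    · rintro (h1 | ⟨w, h1, h3⟩)
      · grind
      · grind
  refine ⟨?_, ?_, ?_, ?_, ?_, ?_, ?_, ?_, ?_, ?_, ?_⟩
  · rintro x y z (h1 | h1 | h1) <;> grind
  · rintro x y z z' (h1 | h1 | h1) (h3 | h3 | h3) <;> grind
  · rintro x y z1 r (h1 | h1 | h1) h3
    · exact Or.inl (p2 _ _ _ _ h1 h3)
    · exact Or.inr (Or.inr (by grind))
    · grind
  · rintro x y z1 r (h1 | h1 | h1) (h3 | h3 | h3) <;> grind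
  · rintro x y z1 (h1 | h1 | h1) <;> grind
  · rintro x y z1 (h1 | h1 | h1) <;> grind
  · rintro x y z1 r (h1 | h1 | h1) (h3 | h3 | h3) <;> grind
  · rintro x y z1 r (h1 | h1 | h1) (h3 | h3 | h3) <;> grind
  · rintro x x' x0 y y' r (h1 | h1 | h1) (h3 | h3 | h3) h5 h6 h7 <;> grind
  · rintro x y z1 (h1 | h1 | h1) h3 <;> grind
  · rintro x y z1 (h1 | h1 | h1) h3 <;> grind

end abstractP

section concrete

abbrev H : Type := ℕ × ℕ →₀ ZMod 2
abbrev N : Type := H × H × ℕ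

noncomputable def S (x : N) : H :=
  open Classical in if x.1 = 0 then Finsupp.single (0, 0) 1 else x.1

def K (m : ℕ) (a : H) : Prop := ∀ i j, m ≤ i → a (i, j) = 0
def V (m : ℕ) (x : N) : Prop := K m x.1 ∧ K m x.2.1

noncomputable def fr (m i : ℕ) : H := Finsupp.single (m, i) 1

theorem fr_ne (m i : ℕ) : fr m i ≠ 0 := by
  unfold fr; simp

theorem fr_K (m i : ℕ) : K (m+1) (fr m i) := by
  intro k j hk
  unfold fr
  rw [Finsupp.single_apply, if_neg]
  intro h
  have := (Prod.mk.inj h).1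
  omega

theorem fr_nK (m i : ℕ) : ¬ K m (fr m i) := by
  intro h
  have := h m i le_rfl
  simp [fr] at this

theorem K0 (m : ℕ) : K m 0 := fun _ _ _ => rfl

theorem Kadd (m : ℕ) (a b : H) (ha : K m a) (hb : K m b) : K m (a + b) := by
  intro i j h
  simp [ha i j h, hb i j h]

theorem Kmono {m n : ℕ} (h : m ≤ n) (a : H) (ha : K m a) : K n a :=
  fun i j hi => ha i j (h.trans hi)

theorem Vmono {m n : ℕ} (h : m ≤ n) (a : N) (ha : V m a) : V n a :=
  ⟨Kmono h _ ha.1, Kmono h _ ha.2⟩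

theorem S_ne (x : N) : S x ≠ 0 := by
  unfold S
  split
  · simp
  · assumption

theorem S_eq (x : N) (h : x.1 ≠ 0) : S x = x.1 := by
  unfold S; rw [if_neg h]

theorem VS {m : ℕ} (hm : 1 ≤ m) (x : N) (hx : V m x) : K m (S x) := by
  unfold S
  split
  · exact Kmono hm _ (fr_K 0 0)
  · exact hx.1

theorem dbl (a : H) : a + a = 0 := by
  ext i
  exact CharTwo.add_self_eq_zero _

theorem add_can (a b : H) (h : a + b = 0) : a = b := by
  have : a + b = b + b := by rw [h, dbl]
  exact add_right_cancel this

theorem Kc (m : ℕ) (a b : H) (ha : K m a) (hb : K m (a + b)) : K m b := by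
  have := Kadd _ _ _ ha hb
  rwa [← add_assoc, dbl, zero_add] at this

theorem exK (a : H) : ∃ m, ∀ n, m ≤ n → K n a := by
  obtain ⟨m, hm⟩ : ∃ m, ∀ p ∈ a.support, p.1 < m := by
    refine ⟨a.support.sup Prod.fst + 1, fun p hp => ?_⟩
    exact Nat.lt_succ_of_le (Finset.le_sup (f := Prod.fst) hp)
  refine ⟨m, fun n hn i j hi => ?_⟩
  by_contra h
  have := hm (i, j) (by simpa using h)
  simp at this
  omega

noncomputable def cN : N → ℕ := Classical.choose (exists_injective_nat N)
theorem cN_inj : Function.Injective cN := Classical.choose_spec (exists_injective_nat N)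
noncomputable def cH : H → ℕ := Classical.choose (exists_injective_nat H)
theorem cH_inj : Function.Injective cH := Classical.choose_spec (exists_injective_nat H)

noncomputable def cc (m : ℕ) (a : H) : ℕ → H
  | 0 => a
  | i+1 => fr m i

theorem cc_apply {m : ℕ} {a : H} (ha : K m a) (i j : ℕ) :
    cc m a i (m, j) = if i = j + 1 then 1 else 0 := by
  cases i with
  | zero => simpa [cc] using ha m j le_rfl
  | succ i => simp [cc, fr, Finsupp.single_apply]

noncomputable def uu (m : ℕ) (a : H) (i : ℕ) (v : N) : N :=
  (cc m a i + cc m a (i+1), 0, Nat.pair i (cN v))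

theorem uu_apply {m : ℕ} {a : H} (ha : K m a) (i : ℕ) :
    (cc m a i + cc m a (i+1)) (m, i) = 1 := by
  rw [Finsupp.add_apply, cc_apply ha, cc_apply ha]; simp

theorem uu_nK {m : ℕ} {a : H} (ha : K m a) (i : ℕ) : ¬ K m (cc m a i + cc m a (i+1)) := by
  intro h
  have := h m i le_rfl
  rw [uu_apply ha] at this
  simp at this

theorem uu_S {m : ℕ} {a : H} (ha : K m a) (i : ℕ) (v : N) :
    S (uu m a i v) = cc m a i + cc m a (i+1) := by
  apply S_eq
  intro h
  apply uu_nK ha i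
  change cc m a i + cc m a (i+1) = 0 at h
  rw [h]; exact K0 m

theorem cc_K {m : ℕ} {a : H} (ha : K m a) (i : ℕ) : K (m+1) (cc m a i) := by
  cases i with
  | zero => exact Kmono (Nat.le_succ m) _ ha
  | succ i => exact fr_K _ _

structure PS where
  m : ℕ
  hm : 1 ≤ m
  E : H → N → N → Prop
  P : N → N → N → Prop
  hE : EInv S (K m) (V m) E
  hP : PInv S (V m) E P

instance : Preorder PS where
  le p q := p.m ≤ q.m ∧ (∀ a x y, p.E a x y → q.E a x y) ∧ (∀ x y z, p.P x y z → q.P x y z)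
  le_refl p := ⟨le_rfl, fun _ _ _ h => h, fun _ _ _ h => h⟩
  le_trans p q r h1 h2 := ⟨h1.1.trans h2.1, fun _ _ _ h => h2.2.1 _ _ _ (h1.2.1 _ _ _ h),
    fun _ _ _ h => h2.2.2 _ _ _ (h1.2.2 _ _ _ h)⟩

theorem EInv_up {m n : ℕ} (hm : 1 ≤ m) (hmn : m ≤ n) {E : H → N → N → Prop}
    (h : EInv S (K m) (V m) E) : EInv S (K n) (V n) E := by
  obtain ⟨kk0, kkadd, vS0, e0, e1, e2, e3, e4a, e4b, e4c, e4d, e5, e6, e7, e8, e10, e11⟩ := h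
  refine ⟨K0 n, Kadd n, VS (hm.trans hmn), ?_, e1, e2, e3, e4a, e4b, e4c, e4d, e5, e6, e7, e8, e10, e11⟩
  intro a x y h
  obtain ⟨h1, h2, h3⟩ := e0 _ _ _ h
  exact ⟨Kmono hmn _ h1, Vmono hmn _ h2, Vmono hmn _ h3⟩

theorem PInv_up {m n : ℕ} (hmn : m ≤ n) {E : H → N → N → Prop} {P : N → N → N → Prop}
    (h : PInv S (V m) E P) : PInv S (V n) E P :=
  PInv_mono h (Vmono hmn) (fun _ _ _ h => h) (fun _ _ _ _ _ h => h) (fun _ _ _ _ _ h => h)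
    (fun _ _ _ _ h => h) (fun _ _ _ _ h => h)

theorem step_up (p : PS) (n : ℕ) : ∃ q, p ≤ q ∧ n ≤ q.m ∧ q.E = p.E ∧ q.P = p.P := by
  have h := le_max_left p.m n
  exact ⟨⟨max p.m n, p.hm.trans h, p.E, p.P, EInv_up p.hm h p.hE, PInv_up h p.hP⟩,
    ⟨h, fun _ _ _ h => h, fun _ _ _ h => h⟩, le_max_right _ _, rfl, rfl⟩

theorem step_FW (p : PS) (a : H) (v0 : N) (ha : K p.m a) (hv0 : V p.m v0)
    (hno : ∀ r, ¬ p.E a v0 r) (hno2 : ∀ w, p.E 0 w v0 → S w ≠ a) :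
    ∃ q, p ≤ q ∧ ∃ r, q.E a v0 r := by
  have hm := p.hm
  have h1 : p.m ≤ p.m + 1 := Nat.le_succ _
  have hu : ∀ i v, ¬ V p.m (uu p.m a i v) := fun i v h => uu_nK ha i h.1
  have hx : ¬ V p.m ((a, fr p.m 0, 0) : N) := fun h => fr_nK _ _ h.2
  have hxu : ∀ i v, uu p.m a i v ≠ (a, fr p.m 0, 0) := by
    intro i v h
    exact fr_ne p.m 0 (congrArg (fun x => x.2.1) h).symm
  have uinj : ∀ i j v w, V p.m v → V p.m w → uu p.m a i v = uu p.m a j w → i = j ∧ v = w := by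
    intro i j v w _ _ h
    have := congrArg (fun x => x.2.2) h
    obtain ⟨h3, h4⟩ := Nat.pair_eq_pair.1 this
    exact ⟨h3, cN_inj h4⟩
  refine ⟨⟨p.m + 1, hm.trans h1, FWE S (V p.m) p.E a v0 (a, fr p.m 0, 0) (cc p.m a) (uu p.m a), p.P,
    ?_, ?_⟩, ⟨h1, fun a x y => FWE.old a x y, fun _ _ _ h => h⟩, uu p.m a 0 v0, FWE.t1 0 v0 hv0 (fun _ => rfl)⟩
  · apply FWE_inv p.hE S_ne dbl (Kmono h1) (Vmono h1) (K0 _) (Kadd _) (VS (hm.trans h1)) a v0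
      (a, fr p.m 0, 0) (cc p.m a) (uu p.m a) ha hv0 hno hno2 rfl (fun i => fr_nK _ _) ?_ (cc_K ha) hu ?_ uinj ?_ ?_ ?_ hx
      ?_ hxu ?_
    · intro i j h
      have h2 := congrArg (fun f : H => f (p.m, i)) h
      by_contra hij
      simp only [cc_apply ha] at h2
      simp [hij] at h2
      exact hij h2.symm
    · intro i v hv
      exact ⟨Kadd _ _ _ (cc_K ha _) (cc_K ha _), K0 _⟩
    · intro i v
      rw [uu_S ha]; exact uu_nK ha i
    · intro i v h
      rw [uu_S ha] at h
      have h2 := congrArg (fun f : H => f (p.m, i)) h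
      simp only [uu_apply ha, cc_apply ha] at h2
      simp at h2
    · intro i v
      rw [uu_S ha, ← add_assoc, dbl, zero_add]
    · exact ⟨Kmono h1 _ ha, fr_K _ _⟩
    · intro h
      apply S_eq
      change a ≠ 0
      rw [h]; exact S_ne _
  · exact FW_P p.hE p.hP S_ne (Vmono h1) a v0 _ _ _ hno hu hx hxu hv0 rfl (fun i => fr_ne _ _) uinj

theorem step_FW2 (p : PS) (a : H) (v0 w0 : N) (hw : p.E 0 w0 v0) (hwa : S w0 = a)
    (hno : ∀ r, ¬ p.E a v0 r) :
    ∃ q, p ≤ q ∧ ∃ r, q.E a v0 r := by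
  have hm := p.hm
  have h1 : p.m ≤ p.m + 1 := Nat.le_succ _
  have hx : ¬ V p.m ((a, fr p.m 0, 0) : N) := fun h => fr_nK _ _ h.2
  have ha : K p.m a := hwa ▸ VS hm _ (p.hE.e0 _ _ _ hw).2.1
  refine ⟨⟨p.m + 1, hm.trans h1, FW2E p.E a v0 (a, fr p.m 0, 0), p.P,
    ?_, ?_⟩, ⟨h1, fun a x y => Or.inl, fun _ _ _ h => h⟩, _, Or.inr (Or.inl ⟨rfl, rfl, rfl⟩)⟩
  · apply FW2E_inv p.hE S_ne dbl (Kmono h1) (Vmono h1) (K0 _) (Kadd _) (VS (hm.trans h1)) a v0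
      (a, fr p.m 0, 0) w0 hw hwa hx ⟨Kmono h1 _ ha, fr_K _ _⟩ ?_ hno
    apply S_eq
    change a ≠ 0
    rw [← hwa]; exact S_ne _
  · exact FW2_P p.hE p.hP S_ne (Vmono h1) a v0 _ w0 hw hwa hx hno

theorem S_fr (m i j : ℕ) : S ((fr m i, 0, j) : N) = fr m i := S_eq _ (fr_ne m i)

theorem nV_fr (m i j : ℕ) : ¬ V m ((fr m i, 0, j) : N) := fun h => fr_nK _ _ h.1

theorem V_fr (m i j : ℕ) : V (m+1) ((fr m i, 0, j) : N) := ⟨fr_K _ _, K0 _⟩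

theorem step_BW (p : PS) (a : H) (y0 : N) (ha : K p.m a) (ha0 : a ≠ 0) (hy0 : V p.m y0)
    (hsp : ¬ Spec S p.E y0 a) (hno : ∀ r, ¬ p.E a r y0) :
    ∃ q, p ≤ q ∧ ∃ r, q.E a r y0 := by
  have hm := p.hm
  have h1 : p.m ≤ p.m + 1 := Nat.le_succ _
  have hSz : ¬ K p.m (S (fr p.m 0, 0, 0)) := by rw [S_fr]; exact fr_nK _ _
  have hs1 : a ≠ S y0 := fun h => hsp (Or.inl h)
  refine ⟨⟨p.m + 1, hm.trans h1, BWE p.E a (fr p.m 0, 0, 0) y0, BWP S p.E p.P a (fr p.m 0, 0, 0) y0,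
    ?_, ?_⟩, ⟨h1, fun a x y => Or.inl, fun _ _ _ => Or.inl⟩, _, Or.inr ⟨rfl, rfl, rfl⟩⟩
  · exact BWE_inv p.hE S_ne (Kmono h1) (Vmono h1) (K0 _) (Kadd _) (VS (hm.trans h1)) a _ y0 ha ha0
      hy0 (nV_fr _ _ _) (V_fr _ _ _) hSz hs1 (fun w h h' => hsp (Or.inr ⟨w, h, h'⟩)) hno
  · exact BW_P p.hE p.hP (Vmono h1) a _ y0 ha ha0 (nV_fr _ _ _) (V_fr _ _ _) hSz hs1 hno

theorem step_BW0 (p : PS) (z : N) (hz : V p.m z) (hno : ∀ r, ¬ p.E 0 r z) :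
    ∃ q, p ≤ q ∧ ∃ r, q.E 0 r z := by
  have hm := p.hm
  have h1 : p.m ≤ p.m + 1 := Nat.le_succ _
  have hSz : ¬ K p.m (S (fr p.m 0, 0, 0)) := by rw [S_fr]; exact fr_nK _ _
  have hne : fr p.m 1 ≠ fr p.m 0 := by
    intro h
    have := congrArg (fun f : H => f (p.m, 0)) h
    simp [fr] at this
  have hux : ∀ b, ((fr p.m 1, 0, cH b) : N) ≠ (fr p.m 0, 0, 0) := fun b h =>
    hne (congrArg (fun x => x.1) h)
  refine ⟨⟨p.m + 1, hm.trans h1, BW0E S p.E z (fr p.m 0, 0, 0) (fun b => (fr p.m 1, 0, cH b)), p.P,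
    ?_, ?_⟩, ⟨h1, fun a x y => Or.inl, fun _ _ _ h => h⟩, _, Or.inr (Or.inl ⟨rfl, rfl, rfl⟩)⟩
  · exact BW0E_inv p.hE S_ne dbl (Kmono h1) (Vmono h1) (K0 _) (Kadd _) (VS (hm.trans h1)) z _ _ hz
      (nV_fr _ _ _) (V_fr _ _ _) (fun b => nV_fr _ _ _) (fun b => V_fr _ _ _) hux
      (fun b b' h => cH_inj (congrArg (fun x => x.2.2) h)) hSz (fr p.m 1) (fun b => S_fr _ _ _)
      (fr_nK _ _) (by rw [S_fr]; exact hne) add_can (Kc _) (fun a b c h => add_right_cancel h) hno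
  · exact BW0_P p.hE p.hP S_ne (Vmono h1) z _ _ hz (nV_fr _ _ _) (fun b => nV_fr _ _ _) hux hSz

theorem step_ADD (p : PS) (y x : N) (hy : V p.m y) (hx : V p.m x) (hxy : y ≠ x)
    (hsp : ¬ sp p.E y x) (hno : ∀ r, ¬ p.P y x r) (hno2 : ∀ r, ¬ p.P x r y)
    (h9 : ∃ r, p.E (S y) r x) : ∃ q, p ≤ q ∧ ∃ r, q.P y x r := by
  have hm := p.hm
  have h1 : p.m ≤ p.m + 1 := Nat.le_succ _
  have hSz : ¬ K p.m (S (fr p.m 0, 0, 0)) := by rw [S_fr]; exact fr_nK _ _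
  exact ⟨⟨p.m + 1, hm.trans h1, p.E, ADDP S p.E p.P (fr p.m 0, 0, 0) y x, EInv_up hm h1 p.hE,
    ADD_P p.hE p.hP (Vmono h1) _ y x hy hx (nV_fr _ _ _) (V_fr _ _ _) hSz hxy hsp hno hno2
    (fun _ => h9)⟩, ⟨h1, fun a x y h => h, fun _ _ _ => Or.inl⟩, _, Or.inr (Or.inl ⟨rfl, rfl, rfl⟩)⟩

theorem up_KV (p : PS) (a : H) (v w : N) : ∃ q, p ≤ q ∧ K q.m a ∧ V q.m v ∧ V q.m w := by
  obtain ⟨m1, h1⟩ := exK a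
  obtain ⟨m2, h2⟩ := exK v.1
  obtain ⟨m3, h3⟩ := exK v.2.1
  obtain ⟨m4, h4⟩ := exK w.1
  obtain ⟨m5, h5⟩ := exK w.2.1
  obtain ⟨q, h, hq, -⟩ := step_up p (m1 + m2 + m3 + m4 + m5)
  exact ⟨q, h, h1 _ (by omega), ⟨h2 _ (by omega), h3 _ (by omega)⟩, h4 _ (by omega), h5 _ (by omega)⟩

theorem cof_fwd (a : H) (v : N) (p : PS) : ∃ q, p ≤ q ∧ ∃ r, q.E a v r := by
  obtain ⟨q, hq, ha, hv, -⟩ := up_KV p a v v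
  by_cases h : ∃ r, q.E a v r
  · exact ⟨q, hq, h⟩
  push Not at h
  by_cases h2 : ∃ w, q.E 0 w v ∧ S w = a
  · obtain ⟨w, hw, hwa⟩ := h2
    obtain ⟨r, hr, h3⟩ := step_FW2 q a v w hw hwa h
    exact ⟨r, hq.trans hr, h3⟩
  · push Not at h2
    obtain ⟨r, hr, h3⟩ := step_FW q a v ha hv h h2
    exact ⟨r, hq.trans hr, h3⟩

theorem cof_bwd (a : H) (v : N) (p : PS) : ∃ q, p ≤ q ∧ ∃ r, q.E a r v := by
  obtain ⟨q, hq, ha, hv, -⟩ := up_KV p a v v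
  by_cases h : ∃ r, q.E a r v
  · exact ⟨q, hq, h⟩
  push Not at h
  by_cases h0 : a = 0
  · subst h0
    obtain ⟨r, hr, h3⟩ := step_BW0 q v hv h
    exact ⟨r, hq.trans hr, h3⟩
  by_cases h2 : Spec S q.E v a
  · obtain ⟨t, ht, r, hr⟩ := cof_fwd a v q
    refine ⟨t, hq.trans ht, r, ?_⟩
    rcases h2 with rfl | ⟨w, hw, rfl⟩
    · exact t.hE.e4a _ _ hr
    · exact t.hE.e4c _ _ _ (ht.2.1 _ _ _ hw) hr
  · obtain ⟨r, hr, h3⟩ := step_BW q a v ha h0 hv h2 h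
    exact ⟨r, hq.trans hr, h3⟩

theorem cof_P (y x : N) (p : PS) : ∃ q, p ≤ q ∧ (y = x ∨ sp q.E y x ∨ ∃ r, q.P y x r) := by
  obtain ⟨p1, hp1, r, hr⟩ := cof_bwd (S y) x p
  obtain ⟨q, hq, -, hy, hx⟩ := up_KV p1 0 y x
  have hr' := hq.2.1 _ _ _ hr
  by_cases h1 : y = x
  · exact ⟨q, hp1.trans hq, Or.inl h1⟩
  by_cases h2 : sp q.E y x
  · exact ⟨q, hp1.trans hq, Or.inr (Or.inl h2)⟩
  by_cases h3 : ∃ r, q.P y x r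
  · exact ⟨q, hp1.trans hq, Or.inr (Or.inr h3)⟩
  push Not at h3
  by_cases h4 : ∃ r, q.P x r y
  · obtain ⟨x0, h4⟩ := h4
    obtain ⟨t, ht, s, hs⟩ := cof_bwd (S x) x0 q
    exact ⟨t, (hp1.trans hq).trans ht, Or.inr (Or.inr ⟨s, t.hP.p2 _ _ _ _ (ht.2.2 _ _ _ h4) hs⟩)⟩
  · push Not at h4
    obtain ⟨t, ht, h5⟩ := step_ADD q y x hy hx h1 h2 h3 h4 ⟨r, hr'⟩
    exact ⟨t, (hp1.trans hq).trans ht, Or.inr (Or.inr h5)⟩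

def PS0 : PS where
  m := 1
  hm := le_rfl
  E := fun _ _ _ => False
  P := fun _ _ _ => False
  hE := by
    refine ⟨K0 1, Kadd 1, VS le_rfl, ?_, ?_, ?_, ?_, ?_, ?_, ?_, ?_, ?_, ?_, ?_, ?_, ?_, ?_⟩ <;> simp
  hP := by
    refine ⟨?_, ?_, ?_, ?_, ?_, ?_, ?_, ?_, ?_, ?_, ?_⟩ <;> simp

theorem exists_limit : ∃ (I : PS → Prop), (∀ p q, I p → I q → ∃ r, I r ∧ p ≤ r ∧ q ≤ r) ∧
    (∀ a v, ∃ p, I p ∧ ∃ r, p.E a v r) ∧ (∀ a v, ∃ p, I p ∧ ∃ r, p.E a r v) ∧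
    (∀ y x, ∃ p, I p ∧ (y = x ∨ sp p.E y x ∨ ∃ r, p.P y x r)) := by
  classical
  let D : (H × N) ⊕ (H × N) ⊕ (N × N) → Order.Cofinal PS := fun i =>
    match i with
    | Sum.inl (a, v) => ⟨{p | ∃ r, p.E a v r}, fun p => by
        obtain ⟨q, h1, h2⟩ := cof_fwd a v p; exact ⟨q, h2, h1⟩⟩
    | Sum.inr (Sum.inl (a, v)) => ⟨{p | ∃ r, p.E a r v}, fun p => by
        obtain ⟨q, h1, h2⟩ := cof_bwd a v p; exact ⟨q, h2, h1⟩⟩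
    | Sum.inr (Sum.inr (y, x)) => ⟨{p | y = x ∨ sp p.E y x ∨ ∃ r, p.P y x r}, fun p => by
        obtain ⟨q, h1, h2⟩ := cof_P y x p; exact ⟨q, h2, h1⟩⟩
  have : Encodable ((H × N) ⊕ (H × N) ⊕ (N × N)) := Encodable.ofCountable _
  refine ⟨fun p => p ∈ Order.idealOfCofinals PS0 D, ?_, ?_, ?_, ?_⟩
  · intro p q hp hq
    obtain ⟨r, hr, h1, h2⟩ := (Order.idealOfCofinals PS0 D).directed p hp q hq
    exact ⟨r, hr, h1, h2⟩
  · intro a v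
    obtain ⟨p, h1, h2⟩ := Order.cofinal_meets_idealOfCofinals PS0 D (Sum.inl (a, v))
    exact ⟨p, h2, h1⟩
  · intro a v
    obtain ⟨p, h1, h2⟩ := Order.cofinal_meets_idealOfCofinals PS0 D (Sum.inr (Sum.inl (a, v)))
    exact ⟨p, h2, h1⟩
  · intro a v
    obtain ⟨p, h1, h2⟩ := Order.cofinal_meets_idealOfCofinals PS0 D (Sum.inr (Sum.inr (a, v)))
    exact ⟨p, h2, h1⟩

end concrete

section final
open Classical in
noncomputable def mop (E : H → N → N → Prop) (L B : H → N → N) (Pf : N → N → N) :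
    H ⊕ N → H ⊕ N → H ⊕ N
  | Sum.inl a, Sum.inl b => Sum.inl (a + b)
  | Sum.inl a, Sum.inr x => Sum.inr (L a x)
  | Sum.inr x, Sum.inl a => Sum.inr (B 0 (B a x))
  | Sum.inr x, Sum.inr y =>
    if x = y then Sum.inl (S x) else
      if h : ∃ a, E a (L 0 x) y then Sum.inl (Classical.choose h + S y) else Sum.inr (Pf x y)

theorem final_aux (E : H → N → N → Prop) (P : N → N → N → Prop) (L B : H → N → N)
    (Pf : N → N → N)
    (hL : ∀ a x, E a x (L a x)) (hB : ∀ a x, E a (B a x) x)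
    (hPf : ∀ y x, y = x ∨ sp E y x ∨ P y x (Pf y x))
    (e1 : ∀ a x y y', E a x y → E a x y' → y = y')
    (e2 : ∀ a x x' y, E a x y → E a x' y → x = x')
    (e3 : ∀ a b x y, E a x y → E b x y → a = b)
    (e4a : ∀ v r, E (S v) v r → E (S v) r v)
    (e5 : ∀ a w v y, E 0 w v → E a v y → ∃ u, E (a + S y) w u ∧ E (S w) u y)
    (e6 : ∀ a x y, E 0 x y → ¬ E a y x)
    (p1 : ∀ x y z z', P x y z → P x y z' → z = z')
    (p2 : ∀ x y z r, P y x z → E (S y) r x → P z y r)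
    (p5 : ∀ x y z, P y x z → z ≠ y ∧ ¬ sp E z y) :
    ∃ (M : Type) (op : M → M → M),
      (∀ x y : M, x = op (op y y) (op (op y x) y)) ∧
      ¬ (∀ x : M, x = op x (op (op x x) (op x x))) := by
  have hLB : ∀ a x, L a (B a x) = x := fun a x => e1 _ _ _ _ (hL _ _) (hB a x)
  have hBL : ∀ a x, B a (L a x) = x := fun a x => e2 _ _ _ _ (hB _ _) (hL a x)
  have m1 : ∀ x, mop E L B Pf (Sum.inr x) (Sum.inr x) = Sum.inl (S x) := by
    intro x; simp [mop]
  have m2 : ∀ x y a, E a (L 0 x) y → mop E L B Pf (Sum.inr x) (Sum.inr y) = Sum.inl (a + S y) := by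
    intro x y a h
    have hne : x ≠ y := by
      rintro rfl
      exact e6 _ _ _ (hL 0 x) h
    have h' : ∃ a, E a (L 0 x) y := ⟨a, h⟩
    have := e3 _ _ _ _ (Classical.choose_spec h') h
    simp only [mop]
    rw [if_neg hne, dif_pos h', this]
  have m3 : ∀ x y, x ≠ y → (¬ ∃ a, E a (L 0 x) y) →
      mop E L B Pf (Sum.inr x) (Sum.inr y) = Sum.inr (Pf x y) := by
    intro x y hne h
    simp only [mop]
    rw [if_neg hne, dif_neg h]
  have hsp : ∀ x y, (∃ a, E a (L 0 x) y) ↔ sp E x y := by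
    intro x y; constructor
    · rintro ⟨a, h⟩; exact ⟨_, a, hL 0 x, h⟩
    · rintro ⟨v, a, h, h'⟩
      exact ⟨a, e1 _ _ _ _ h (hL 0 x) ▸ h'⟩
  refine ⟨H ⊕ N, mop E L B Pf, ?_, ?_⟩
  · rintro (b | x) (a | y)
    · have : b = (a + a) + ((a + b) + a) := by
        rw [dbl, zero_add, add_comm a b, add_assoc, dbl, add_zero]
      exact congrArg Sum.inl this
    · rw [m1]
      change _ = mop E L B Pf _ (mop E L B Pf (Sum.inr (B 0 (B b y))) _)
      rw [m2 _ _ b (by rw [hLB]; exact hB b y)]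
      have : b = S y + (b + S y) := by
        rw [add_comm b, ← add_assoc, dbl, zero_add]
      exact congrArg Sum.inl this
    · have : x = L (a + a) (B 0 (B a (L a x))) := by
        rw [dbl, hBL, hLB]
      exact congrArg Sum.inr this
    · rw [m1]
      by_cases hxy : y = x
      · subst hxy
        rw [m1]
        have : y = L (S y) (L (S y) y) := e1 _ _ _ _ (e4a _ _ (hL _ _)) (hL _ _)
        exact congrArg Sum.inr this
      by_cases h : ∃ a, E a (L 0 y) x
      · obtain ⟨a, ha⟩ := h
        rw [m2 _ _ _ ha]
        obtain ⟨u, h1, h2⟩ := e5 _ _ _ _ (hL 0 y) ha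
        have : x = L (S y) (L (a + S x) y) := by
          rw [← e1 _ _ _ _ h1 (hL _ _)]
          exact e1 _ _ _ _ h2 (hL _ _)
        exact congrArg Sum.inr this
      · rw [m3 _ _ hxy h]
        have hz : P y x (Pf y x) := by
          rcases hPf y x with h1 | h1 | h1
          · exact (hxy h1).elim
          · exact (h ((hsp _ _).2 h1)).elim
          · exact h1
        obtain ⟨h3, h4⟩ := p5 _ _ _ hz
        rw [m3 _ _ h3 (fun h5 => h4 ((hsp _ _).1 h5))]
        have h5 := p2 _ _ _ _ hz (hB (S y) x)
        have h6 : Pf (Pf y x) y = B (S y) x := by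
          rcases hPf (Pf y x) y with h1 | h1 | h1
          · exact (h3 h1).elim
          · exact (h4 h1).elim
          · exact p1 _ _ _ _ h1 h5
        rw [h6]
        have : x = L (S y) (B (S y) x) := (hLB _ _).symm
        exact congrArg Sum.inr this
  · intro h
    have h1 := h (Sum.inr (0, 0, 0))
    rw [m1] at h1
    change _ = Sum.inr (B 0 (B (S _ + S _) _)) at h1
    rw [dbl] at h1
    have h2 := Sum.inr.inj h1
    have h3 := hB 0 (B 0 ((0, 0, 0) : N))
    rw [← h2] at h3
    exact e6 _ _ _ h3 (hB 0 _)

theorem final : ∃ (M : Type) (op : M → M → M),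
      (∀ x y : M, x = op (op y y) (op (op y x) y)) ∧
      ¬ (∀ x : M, x = op x (op (op x x) (op x x))) := by
  obtain ⟨I, hdir, hf, hb, hp⟩ := exists_limit
  let E : H → N → N → Prop := fun a x y => ∃ p, I p ∧ p.E a x y
  let P : N → N → N → Prop := fun x y z => ∃ p, I p ∧ p.P x y z
  have hf' : ∀ a x, ∃ r, E a x r := fun a x => by
    obtain ⟨p, h1, r, h2⟩ := hf a x; exact ⟨r, p, h1, h2⟩
  have hb' : ∀ a x, ∃ r, E a r x := fun a x => by
    obtain ⟨p, h1, r, h2⟩ := hb a x; exact ⟨r, p, h1, h2⟩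
  have hp' : ∀ y x, ∃ r, y = x ∨ sp E y x ∨ P y x r := fun y x => by
    obtain ⟨p, h1, h2 | ⟨v, b, h2, h3⟩ | ⟨r, h2⟩⟩ := hp y x
    · exact ⟨x, Or.inl h2⟩
    · exact ⟨x, Or.inr (Or.inl ⟨v, b, ⟨p, h1, h2⟩, ⟨p, h1, h3⟩⟩)⟩
    · exact ⟨r, Or.inr (Or.inr ⟨p, h1, h2⟩)⟩
  choose L hL using hf'
  choose B hB using hb'
  choose Pf hPf using hp'
  have EE : ∀ {a x y b z w}, E a x y → E b z w → ∃ p, I p ∧ p.E a x y ∧ p.E b z w := by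
    rintro a x y b z w ⟨p, h1, h2⟩ ⟨q, h3, h4⟩
    obtain ⟨r, h5, h6, h7⟩ := hdir p q h1 h3
    exact ⟨r, h5, h6.2.1 _ _ _ h2, h7.2.1 _ _ _ h4⟩
  have PE : ∀ {a x y b z w}, P a x y → E b z w → ∃ p, I p ∧ p.P a x y ∧ p.E b z w := by
    rintro a x y b z w ⟨p, h1, h2⟩ ⟨q, h3, h4⟩
    obtain ⟨r, h5, h6, h7⟩ := hdir p q h1 h3
    exact ⟨r, h5, h6.2.2 _ _ _ h2, h7.2.1 _ _ _ h4⟩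
  refine final_aux E P L B Pf hL hB hPf ?_ ?_ ?_ ?_ ?_ ?_ ?_ ?_ ?_
  · intro a x y y' h1 h2
    obtain ⟨p, -, h1, h2⟩ := EE h1 h2
    exact p.hE.e1 _ _ _ _ h1 h2
  · intro a x y y' h1 h2
    obtain ⟨p, -, h1, h2⟩ := EE h1 h2
    exact p.hE.e2 _ _ _ _ h1 h2
  · intro a x y y' h1 h2
    obtain ⟨p, -, h1, h2⟩ := EE h1 h2
    exact p.hE.e3 _ _ _ _ h1 h2
  · rintro v r ⟨p, hI, h⟩
    exact ⟨p, hI, p.hE.e4a _ _ h⟩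
  · intro a w v y h1 h2
    obtain ⟨p, hI, h1, h2⟩ := EE h1 h2
    obtain ⟨u, h3, h4⟩ := p.hE.e5 _ _ _ _ h1 h2
    exact ⟨u, ⟨p, hI, h3⟩, ⟨p, hI, h4⟩⟩
  · intro a x y h1 h2
    obtain ⟨p, hI, h1, h2⟩ := EE h1 h2
    exact p.hE.e6 _ _ _ h1 h2
  · rintro x y z z' ⟨p, h1, h2⟩ ⟨q, h3, h4⟩
    obtain ⟨r, h5, h6, h7⟩ := hdir p q h1 h3
    exact r.hP.p1 _ _ _ _ (h6.2.2 _ _ _ h2) (h7.2.2 _ _ _ h4)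
  · intro x y z r h1 h2
    obtain ⟨p, hI, h1, h2⟩ := PE h1 h2
    exact ⟨p, hI, p.hP.p2 _ _ _ _ h1 h2⟩
  · intro x y z h1
    constructor
    · obtain ⟨p, -, h⟩ := h1
      exact (p.hP.p5 _ _ _ h).1
    · rintro ⟨v, b, h2, h3⟩
      obtain ⟨q, hq, h2, h3⟩ := EE h2 h3
      obtain ⟨p, hI, h⟩ := h1
      obtain ⟨r, h5, h6, h7⟩ := hdir p q hI hq
      exact (r.hP.p5 _ _ _ (h6.2.2 _ _ _ h)).2 ⟨v, b, h7.2.1 _ _ _ h2, h7.2.1 _ _ _ h3⟩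

end final

end Sq

theorem Equation1729_not_implies_Equation817 :
    ∃ (M : Type) (op : M → M → M),
      (∀ x y : M, x = op (op y y) (op (op y x) y)) ∧
      ¬ (∀ x : M, x = op x (op (op x x) (op x x))) := by
  exact Sq.final
end

section
/- Let M be a finite type and let f, g : M → M. If f = f ∘ f ∘ g, then f = f ∘ g ∘ f. (A fact about functions on finite sets used to establish additional implications for finite magmas.) -/
/-- For functions `f g : M → M` on a finite type `M`, if `f = f ∘ f ∘ g`, then
`f = f ∘ g ∘ f`. -/
theorem comp_fact_of_finite (M : Type*) [Finite M] (f g : M → M)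
    (h : f = f ∘ f ∘ g) : f = f ∘ g ∘ f := by
  have h' : ∀ x, f x = f (f (g x)) := fun x => congrFun h x
  let F : Set.range f → Set.range f := fun y => ⟨f y.1, y.1, rfl⟩
  have hs : Function.Surjective F := by
    rintro ⟨y, x, rfl⟩
    exact ⟨⟨f (g x), g x, rfl⟩, Subtype.ext (h' x).symm⟩
  have hi : Function.Injective F := Finite.injective_iff_surjective.mpr hs
  funext x
  have e : F ⟨f x, x, rfl⟩ = F ⟨f (g (f x)), g (f x), rfl⟩ := Subtype.ext (h' (f x))
  exact congrArg Subtype.val (hi e)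
end

section
/- Canonizer theorem: let X be a type, let E be the law (l, r) over X with l not a single variable, and let R : FreeMagma X → FreeMagma X. Define C_R : FreeMagma X → FreeMagma X recursively by C_R(x) = x for x ∈ X and C_R(w ⋄ w′) = R(C_R(w) ⋄ C_R(w′)). Suppose: (a) R is weakly collapsing, i.e. for every word w, R(w) is a (not necessarily proper) subterm of w; (b) R is a weak canonizer for E, i.e. for every substitution θ : X → FreeMagma X, R(φ_θ l) = φ_θ r, where φ_θ is the induced endomorphism of FreeMagma X; (c) R is non-overlapping for E, i.e. for every word w that is a strict subterm of l and not a single variable, and every substitution θ, R(φ_θ w) = φ_θ w. Then C_R is a canonizer for E: whenever w₁ ∼_E w₂, one has C_R(w₁) = C_R(w₂). -/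
universe u v

/-- The subterm relation on the free magma: `Subterm w w'` means `w` is a
(not necessarily proper) subterm of `w'`. -/
inductive Subterm {X : Type v} : FreeMagma X → FreeMagma X → Prop
  | refl (w : FreeMagma X) : Subterm w w
  | left {w w₁ w₂ : FreeMagma X} : Subterm w w₁ → Subterm w (w₁ * w₂)
  | right {w w₁ w₂ : FreeMagma X} : Subterm w w₂ → Subterm w (w₁ * w₂)

/-- The map `C_R` defined recursively by `C_R x = x` on generators and
`C_R (w ⋄ w') = R (C_R w ⋄ C_R w')`. -/
def CanonMap {X : Type v} (R : FreeMagma X → FreeMagma X) :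
    FreeMagma X → FreeMagma X
  | .of x => .of x
  | .mul w w' => R (CanonMap R w * CanonMap R w')

/-- A magma `M` satisfies the law `(u, v)` over `X` if every assignment of the
variables makes the two sides equal. -/
def LawSatisfied {X : Type v} (E : FreeMagma X × FreeMagma X) (M : Type u) [Mul M] : Prop :=
  ∀ f : X → M, FreeMagma.lift f E.1 = FreeMagma.lift f E.2

/-- `w ∼_E w'`: every magma satisfying the law `E` satisfies the law `(w, w')`. -/
def LawEquiv {X : Type v} (E : FreeMagma X × FreeMagma X)
    (w w' : FreeMagma X) : Prop :=
  ∀ (M : Type u) [Mul M], LawSatisfied E M → LawSatisfied (w, w') M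

def wvars {X : Type v} : FreeMagma X → Set X
  | .of x => {x}
  | .mul a b => wvars a ∪ wvars b

theorem wvars_countable {X : Type v} (w : FreeMagma X) : (wvars w).Countable := by
  induction w with
  | ih1 x => exact Set.countable_singleton x
  | ih2 a b iha ihb => exact iha.union ihb

theorem wvars_nonempty {X : Type v} (w : FreeMagma X) : (wvars w).Nonempty := by
  induction w with
  | ih1 x => exact ⟨x, rfl⟩
  | ih2 a b iha ihb => exact iha.mono Set.subset_union_left

def GoodW {X : Type v} (R : FreeMagma X → FreeMagma X) (S : Set X) : FreeMagma X → Prop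
  | .of x => x ∈ S
  | .mul a b => GoodW R S a ∧ GoodW R S b ∧ R (a * b) = a * b

theorem GoodW.sub {X : Type v} {R : FreeMagma X → FreeMagma X} {S : Set X}
    {w w' : FreeMagma X} (h : Subterm w w') : GoodW R S w' → GoodW R S w := by
  induction h with
  | refl => exact id
  | left _ ih => exact fun h => ih h.1
  | right _ ih => exact fun h => ih h.2.1

theorem GoodW.mul_closed {X : Type v} {R : FreeMagma X → FreeMagma X} {S : Set X}
    (hc : ∀ w : FreeMagma X, Subterm (R w) w) {a b : FreeMagma X}
    (ha : GoodW R S a) (hb : GoodW R S b) : GoodW R S (R (a * b)) := by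
  have key : ∀ u w : FreeMagma X, Subterm u w → w = a * b → R (a * b) = u → GoodW R S u := by
    intro u w h hw hu
    cases h with
    | refl =>
      subst hw
      exact ⟨ha, hb, hu⟩
    | left h =>
      injection hw with h1 h2
      subst h1
      exact GoodW.sub h ha
    | right h =>
      injection hw with h1 h2
      subst h2
      exact GoodW.sub h hb
  exact key _ _ (hc _) rfl rfl

def wcode {X : Type v} (g : X → ℕ) : FreeMagma X → ℕ
  | .of x => Nat.pair 0 (g x)
  | .mul a b => Nat.pair 1 (Nat.pair (wcode g a) (wcode g b))

theorem wcode_inj {X : Type v} {R : FreeMagma X → FreeMagma X} {S : Set X} {g : X → ℕ}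
    (hg : Set.InjOn g S) (a : FreeMagma X) : ∀ b, GoodW R S a → GoodW R S b →
    wcode g a = wcode g b → a = b := by
  induction a with
  | ih1 x =>
    intro b ha hb h
    cases b with
    | of y =>
      have := (Nat.pair_eq_pair.1 h).2
      rw [hg ha hb this]
    | mul c d =>
      have := (Nat.pair_eq_pair.1 h).1
      omega
  | ih2 a1 a2 ih1 ih2 =>
    intro b ha hb h
    cases b with
    | of y =>
      have := (Nat.pair_eq_pair.1 h).1
      omega
    | mul c d =>
      have := Nat.pair_eq_pair.1 (Nat.pair_eq_pair.1 h).2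
      have e1 := ih1 c ha.1 hb.1 this.1
      have e2 := ih2 d ha.2.1 hb.2.1 this.2
      subst e1 e2
      rfl

theorem goodW_countable {X : Type v} (R : FreeMagma X → FreeMagma X) {S : Set X}
    (hS : S.Countable) : Countable {w // GoodW R S w} := by
  obtain ⟨g, hg⟩ := Set.countable_iff_exists_injOn.1 hS
  refine Function.Injective.countable (f := fun w : {w // GoodW R S w} => wcode g w.1) ?_
  intro a b h
  exact Subtype.ext (wcode_inj hg _ _ a.2 b.2 h)

theorem subterm_length {X : Type v} {w w' : FreeMagma X} (h : Subterm w w') :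
    w.length ≤ w'.length := by
  induction h with
  | refl => exact le_rfl
  | left _ ih => exact ih.trans (Nat.le_add_right _ _)
  | right _ ih => exact ih.trans (Nat.le_add_left _ _)

theorem map_lift_w {X : Type v} {M : Type*} {N : Type*} [Mul M] [Mul N] (φ : M →ₙ* N)
    (f : X → M) (w : FreeMagma X) :
    φ (FreeMagma.lift f w) = FreeMagma.lift (fun x => φ (f x)) w := by
  induction w with
  | ih1 x => simp
  | ih2 a b iha ihb =>
    simp [iha, ihb]

/-- Canonizer theorem: if `R` is weakly collapsing, a weak canonizer for the
law `(l, r)` (with `l` not a single variable), and non-overlapping for it,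
then `C_R` is a canonizer: `w₁ ∼_E w₂` implies `C_R w₁ = C_R w₂`. -/
theorem canonMap_is_canonizer {X : Type v} (l r : FreeMagma X)
    (hl : ∀ x : X, l ≠ FreeMagma.of x)
    (R : FreeMagma X → FreeMagma X)
    (hcollapse : ∀ w : FreeMagma X, Subterm (R w) w)
    (hweak : ∀ θ : X → FreeMagma X,
      R (FreeMagma.lift θ l) = FreeMagma.lift θ r)
    (hnonoverlap : ∀ w : FreeMagma X, Subterm w l → w ≠ l →
      (∀ x : X, w ≠ FreeMagma.of x) →
      ∀ θ : X → FreeMagma X, R (FreeMagma.lift θ w) = FreeMagma.lift θ w)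
    (w₁ w₂ : FreeMagma X) (h : LawEquiv.{u} (l, r) w₁ w₂) :
    CanonMap R w₁ = CanonMap R w₂ := by
  classical
  let S : Set X := wvars w₁ ∪ wvars w₂
  have hS : S.Countable := (wvars_countable w₁).union (wvars_countable w₂)
  obtain ⟨x0, hx0'⟩ := wvars_nonempty w₁
  have hx0 : x0 ∈ S := Or.inl hx0'
  haveI : Countable {w // GoodW R S w} := goodW_countable R hS
  letI : Mul {w // GoodW R S w} :=
    ⟨fun a b => ⟨R (a.1 * b.1), GoodW.mul_closed hcollapse a.2 b.2⟩⟩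
  have hmul : ∀ a b : {w // GoodW R S w}, (a * b).1 = R (a.1 * b.1) := fun _ _ => rfl
  -- the law holds
  have hlaw : ∀ f : X → {w // GoodW R S w}, FreeMagma.lift f l = FreeMagma.lift f r := by
    intro f
    let θ : X → FreeMagma X := fun x => (f x).1
    have strict : ∀ w : FreeMagma X, Subterm w l → w.length < l.length →
        (∀ w', Subterm w' w → Subterm w' l) →
        (FreeMagma.lift f w).1 = FreeMagma.lift θ w := by
      intro w
      induction w with
      | ih1 x => intro _ _ _; simp [θ]
      | ih2 a b iha ihb =>
        intro h1 h2 h3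
        have ea := iha (h3 _ (.left (.refl _)))
          (lt_of_le_of_lt (subterm_length (.left (.refl _))) h2) (fun w' h => h3 _ (.left h))
        have eb := ihb (h3 _ (.right (.refl _)))
          (lt_of_le_of_lt (subterm_length (.right (.refl _))) h2) (fun w' h => h3 _ (.right h))
        have := hnonoverlap (a * b) h1 (fun e => by
          have e' : (a * b).length = l.length := congrArg _ e
          exact absurd h2 (by have := e'; omega)) (fun x e => by injection e) θ
        rw [map_mul] at this
        rw [map_mul, map_mul, hmul, ea, eb, this]
    have hL : (FreeMagma.lift f l).1 = FreeMagma.lift θ r := by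
      rw [← hweak θ]
      cases l with
      | of x => exact absurd rfl (hl x)
      | mul a b =>
        have ea := strict a (.left (.refl _))
          (Nat.lt_add_of_pos_right b.length_pos) (fun w' h => .left h)
        have eb := strict b (.right (.refl _))
          (Nat.lt_add_of_pos_left a.length_pos) (fun w' h => .right h)
        have e1 : FreeMagma.lift f (a * b) = FreeMagma.lift f a * FreeMagma.lift f b := map_mul _ _ _
        have e2 : FreeMagma.lift θ (a * b) = FreeMagma.lift θ a * FreeMagma.lift θ b := map_mul _ _ _
        change (FreeMagma.lift f (a * b)).1 = R (FreeMagma.lift θ (a * b))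
        rw [e1, e2, hmul, ea, eb]
    have hr : ∀ w : FreeMagma X, GoodW R S (FreeMagma.lift θ w) →
        (FreeMagma.lift f w).1 = FreeMagma.lift θ w := by
      intro w
      induction w with
      | ih1 x => intro _; simp [θ]
      | ih2 a b iha ihb =>
        intro hg
        rw [map_mul] at hg
        rw [map_mul, map_mul, hmul, iha hg.1, ihb hg.2.1]
        exact hg.2.2
    apply Subtype.ext
    rw [hL]
    exact (hr r (hL ▸ (FreeMagma.lift f l).2)).symm
  let e : Shrink.{u} {w // GoodW R S w} ≃* {w // GoodW R S w} := Shrink.mulEquiv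
  have hM : LawSatisfied (l, r) (Shrink.{u} {w // GoodW R S w}) := by
    intro f
    apply e.injective
    have := hlaw (fun x => e (f x))
    have k := map_lift_w e.toMulHom f
    exact (k l).trans (this.trans (k r).symm)
  let f0 : X → {w // GoodW R S w} := fun x =>
    if hx : x ∈ S then ⟨.of x, hx⟩ else ⟨.of x0, hx0⟩
  have hfin : FreeMagma.lift f0 w₁ = FreeMagma.lift f0 w₂ := by
    have := h _ hM (fun x => e.symm (f0 x))
    have k := map_lift_w e.symm.toMulHom f0
    exact e.symm.injective ((k w₁).trans (this.trans (k w₂).symm))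
  have hev : ∀ w : FreeMagma X, wvars w ⊆ S → (FreeMagma.lift f0 w).1 = CanonMap R w := by
    intro w
    induction w with
    | ih1 x =>
      intro hw
      have hx : x ∈ S := hw rfl
      change (f0 x).1 = .of x
      simp only [f0, dif_pos hx]
    | ih2 a b iha ihb =>
      intro hw
      rw [map_mul, hmul, iha (Set.subset_union_left.trans hw), ihb (Set.subset_union_right.trans hw)]
      rfl
  rw [← hev w₁ Set.subset_union_left, ← hev w₂ Set.subset_union_right, hfin]
end

section
/- Substitution lemma for canonizers: let X be a type, E the law (l, r) over X with l not a single variable, and R : FreeMagma X → FreeMagma X non-overlapping for E (for every word w that is a strict subterm of l and not a single variable, and every substitution θ, R(φ_θ w) = φ_θ w). Define C_R recursively by C_R(x) = x for x ∈ X and C_R(w ⋄ w′) = R(C_R(w) ⋄ C_R(w′)). Then for every word t that is a strict subterm of l and every substitution θ : X → FreeMagma X, C_R(φ_θ t) = φ_{C_R ∘ θ} t. -/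
universe v

theorem Subterm.trans' {X : Type v} {a b c : FreeMagma X} (h : Subterm a b) (h' : Subterm b c) :
    Subterm a c := by
  induction h' with
  | refl => exact h
  | left _ ih => exact .left ih
  | right _ ih => exact .right ih

theorem Subterm.length_le {X : Type v} {a b : FreeMagma X} (h : Subterm a b) :
    a.length ≤ b.length := by
  induction h with
  | refl => exact le_rfl
  | @left w₁ w₂ _ ih =>
    have : (w₁ * w₂).length = w₁.length + w₂.length := rfl
    omega
  | @right w₁ w₂ _ ih =>
    have : (w₁ * w₂).length = w₁.length + w₂.length := rfl
    omega

/-- Substitution lemma for canonizers: if `R` is non-overlapping for the law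
`(l, r)` (with `l` not a single variable), then for every strict subterm `t`
of `l` and every substitution `θ`, `C_R (φ_θ t) = φ_{C_R ∘ θ} t`. -/
theorem canonMap_substitution {X : Type v} (l r : FreeMagma X)
    (hl : ∀ x : X, l ≠ FreeMagma.of x)
    (R : FreeMagma X → FreeMagma X)
    (hnonoverlap : ∀ w : FreeMagma X, Subterm w l → w ≠ l →
      (∀ x : X, w ≠ FreeMagma.of x) →
      ∀ θ : X → FreeMagma X, R (FreeMagma.lift θ w) = FreeMagma.lift θ w)
    (t : FreeMagma X) (ht : Subterm t l) (ht' : t ≠ l)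
    (θ : X → FreeMagma X) :
    CanonMap R (FreeMagma.lift θ t) = FreeMagma.lift (CanonMap R ∘ θ) t := by
  induction t with
  | ih1 x => rfl
  | ih2 a b iha ihb =>
    have hlen : (a * b).length = a.length + b.length := rfl
    have hle := ht.length_le
    have ha := a.length_pos
    have hb := b.length_pos
    have h1 := iha (Subterm.trans' (.left (.refl a)) ht) (by rintro rfl; omega)
    have h2 := ihb (Subterm.trans' (.right (.refl b)) ht) (by rintro rfl; omega)
    have h3 := hnonoverlap (a * b) ht ht' (fun x h => by cases h) (CanonMap R ∘ θ)
    rw [map_mul] at h3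
    change CanonMap R (FreeMagma.lift θ (a * b)) = FreeMagma.lift (CanonMap R ∘ θ) (a * b)
    rw [map_mul, map_mul]
    change R (CanonMap R (FreeMagma.lift θ a) * CanonMap R (FreeMagma.lift θ b)) = _
    rw [h1, h2, h3]
end

section
/- Unique factorization in the free magma of a left-absorptive law: let X be a type, let f be a word in FreeMagma (Fin 3) (in three indeterminates x, y, z), and let E be the law x ≃ x ⋄ f(x, y, z) over X (i.e. for each assignment, the left side is the first variable and the right side is that variable ⋄ the instantiation of f). Assume E entails Equation378 (∀ x y, x ⋄ y = (x ⋄ y) ⋄ y). Define w′ →_E w to mean w ∼_E w ⋄ w′, and call a word w irreducible if it is not of the form w₁ ⋄ w₂ with w₂ →_E w₁. Then two irreducible words w, w′ of FreeMagma X satisfy w ∼_E w′ if and only if either they are the same generator of X, or w = w₁ ⋄ w₂ and w′ = w₁′ ⋄ w₂′ with w₁ ∼_E w₁′ and w₂ ∼_E w₂′. -/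
universe u v

/-- A magma `M` satisfies the left-absorptive law `x ≃ x ⋄ f(x, y, z)`
(with `f` a word in three indeterminates, numbered `0 = x`, `1 = y`, `2 = z`)
if for every assignment `g : Fin 3 → M` one has `g 0 = g 0 * φ_g f`. -/
def SatLeftAbsorb (f : FreeMagma (Fin 3)) (M : Type u) [Mul M] : Prop :=
  ∀ g : Fin 3 → M, g 0 = g 0 * FreeMagma.lift g f

/-- `w ∼_E w'` for the law `E : x ≃ x ⋄ f(x, y, z)`: every magma satisfying
`E` satisfies the law `(w, w')`. -/
def SimE {X : Type v} (f : FreeMagma (Fin 3)) (w w' : FreeMagma X) : Prop :=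
  ∀ (M : Type u) [Mul M], SatLeftAbsorb f M →
    ∀ g : X → M, FreeMagma.lift g w = FreeMagma.lift g w'

/-- `w' →_E w` means `w ∼_E w ⋄ w'`. -/
def ArrowE {X : Type v} (f : FreeMagma (Fin 3)) (w' w : FreeMagma X) : Prop :=
  SimE.{u} f w (w * w')

/-- A word is irreducible if it is not of the form `w₁ ⋄ w₂` with `w₂ →_E w₁`. -/
def IrreducibleWord {X : Type v} (f : FreeMagma (Fin 3)) (w : FreeMagma X) : Prop :=
  ¬ ∃ w₁ w₂ : FreeMagma X, w = w₁ * w₂ ∧ ArrowE.{u} f w₂ w₁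

theorem hom_lift_aux {X : Type*} {M : Type*} {N : Type*} [Mul M] [Mul N] (φ : M →ₙ* N)
    (g : X → M) (w : FreeMagma X) :
    φ (FreeMagma.lift g w) = FreeMagma.lift (fun x => φ (g x)) w := by
  induction w with
  | ih1 x => simp
  | ih2 a b ha hb => simp only [map_mul, ha, hb]

theorem satProd_aux (f : FreeMagma (Fin 3)) (M N : Type u) [Mul M] [Mul N]
    (hM : SatLeftAbsorb f M) (hN : SatLeftAbsorb f N) : SatLeftAbsorb f (M × N) := by
  intro g
  have h1 := hom_lift_aux (MulHom.fst M N) g f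
  have h2 := hom_lift_aux (MulHom.snd M N) g f
  have h3 := hM (fun i => (g i).1)
  have h4 := hN (fun i => (g i).2)
  apply Prod.ext
  · exact h3.trans (congrArg (fun t => (g 0).1 * t) h1.symm)
  · exact h4.trans (congrArg (fun t => (g 0).2 * t) h2.symm)

/-- Tagged elements of a magma. -/
structure TagMagma (G : Type u) : Type u where
  val : G
  tag : ULift.{u} Prop ⊕ (G × G)

open Classical in
noncomputable instance tagMul (G : Type u) [Mul G] : Mul (TagMagma G) :=
  ⟨fun p q => if p.val * q.val = p.val then p else ⟨p.val * q.val, Sum.inr (p.val, q.val)⟩⟩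

theorem tag_mul_pos (G : Type u) [Mul G] (p q : TagMagma G) (h : p.val * q.val = p.val) :
    p * q = p := if_pos h

theorem tag_mul_neg (G : Type u) [Mul G] (p q : TagMagma G) (h : p.val * q.val ≠ p.val) :
    p * q = ⟨p.val * q.val, Sum.inr (p.val, q.val)⟩ := if_neg h

def tagVal (G : Type u) [Mul G] : TagMagma G →ₙ* G where
  toFun := TagMagma.val
  map_mul' p q := by
    by_cases h : p.val * q.val = p.val
    · rw [tag_mul_pos G p q h, h]
    · rw [tag_mul_neg G p q h]

theorem satTag_aux (f : FreeMagma (Fin 3)) (G : Type u) [Mul G]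
    (hG : SatLeftAbsorb f G) : SatLeftAbsorb f (TagMagma G) := by
  intro g
  refine (tag_mul_pos G _ _ ?_).symm
  have h1 := hom_lift_aux (tagVal G) g f
  have h3 := hG (fun i => (g i).val)
  exact (congrArg (fun t => (g 0).val * t) h1).trans h3.symm

/-- The assignment in the tagged magma. -/
def tagAssign {X : Type v} {G : Type u} (g : X → G) (b : X → Prop) (x : X) : TagMagma G :=
  ⟨g x, Sum.inl ⟨b x⟩⟩

theorem tag_val_lift {X : Type v} {G : Type u} [Mul G] (g : X → G) (b : X → Prop)
    (w : FreeMagma X) :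
    (FreeMagma.lift (tagAssign g b) w).val = FreeMagma.lift g w :=
  hom_lift_aux (tagVal G) (tagAssign g b) w

theorem tag_lift_mul {X : Type v} {G : Type u} [Mul G] (g : X → G) (b : X → Prop)
    (w₁ w₂ : FreeMagma X) (h : FreeMagma.lift g w₁ ≠ FreeMagma.lift g (w₁ * w₂)) :
    (FreeMagma.lift (tagAssign g b) (w₁ * w₂)).tag =
      Sum.inr (FreeMagma.lift g w₁, FreeMagma.lift g w₂) := by
  rw [map_mul, tag_mul_neg]
  · simp only [tag_val_lift]
  · rw [tag_val_lift, tag_val_lift, ← map_mul]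
    exact h.symm

theorem irred_aux {X : Type v} (f : FreeMagma (Fin 3)) (w₁ w₂ : FreeMagma X)
    (h : IrreducibleWord.{u} f (w₁ * w₂)) :
    ∃ (G : Type u) (_ : Mul G), SatLeftAbsorb f G ∧ ∃ g : X → G,
      FreeMagma.lift g w₁ ≠ FreeMagma.lift g (w₁ * w₂) := by
  by_contra hc
  refine h ⟨w₁, w₂, rfl, ?_⟩
  intro M _ hM g
  by_contra hne
  exact hc ⟨M, _, hM, g, hne⟩

theorem mixed_aux {X : Type v} (f : FreeMagma (Fin 3)) (x : X) (w₁ w₂ : FreeMagma X)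
    (h : IrreducibleWord.{u} f (w₁ * w₂)) (hs : SimE.{u} f (FreeMagma.of x) (w₁ * w₂)) :
    False := by
  obtain ⟨G, _, hG, g, hg⟩ := irred_aux f w₁ w₂ h
  have h1 := congrArg TagMagma.tag (hs (TagMagma G) (satTag_aux f G hG) (tagAssign g fun _ => True))
  rw [tag_lift_mul g _ w₁ w₂ hg, FreeMagma.lift_of] at h1
  simp [tagAssign] at h1

theorem prod_aux {X : Type v} (f : FreeMagma (Fin 3)) (w₁ w₂ w₁' w₂' : FreeMagma X)
    (h : IrreducibleWord.{u} f (w₁ * w₂)) (h' : IrreducibleWord.{u} f (w₁' * w₂'))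
    (hs : SimE.{u} f (w₁ * w₂) (w₁' * w₂')) (M : Type u) [Mul M] (hM : SatLeftAbsorb f M)
    (g : X → M) : FreeMagma.lift g w₁ = FreeMagma.lift g w₁' ∧
      FreeMagma.lift g w₂ = FreeMagma.lift g w₂' := by
  obtain ⟨G, _, hG, k, hk⟩ := irred_aux f w₁ w₂ h
  obtain ⟨G', _, hG', k', hk'⟩ := irred_aux f w₁' w₂' h'
  let γ : X → M × (G × G') := fun x => (g x, (k x, k' x))
  have e1 : ∀ u, (FreeMagma.lift γ u).1 = FreeMagma.lift g u :=
    hom_lift_aux (MulHom.fst M (G × G')) γ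
  have e2 : ∀ u, (FreeMagma.lift γ u).2.1 = FreeMagma.lift k u :=
    hom_lift_aux ((MulHom.fst G G').comp (MulHom.snd M (G × G'))) γ
  have e3 : ∀ u, (FreeMagma.lift γ u).2.2 = FreeMagma.lift k' u :=
    hom_lift_aux ((MulHom.snd G G').comp (MulHom.snd M (G × G'))) γ
  have h1 := congrArg TagMagma.tag (hs (TagMagma (M × (G × G')))
    (satTag_aux f _ (satProd_aux f _ _ hM (satProd_aux f _ _ hG hG')))
    (tagAssign γ fun _ => True))
  rw [tag_lift_mul, tag_lift_mul] at h1
  · have h2 := Prod.mk.inj (Sum.inr.inj h1)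
    rw [← e1, ← e1, ← e1, ← e1, h2.1, h2.2]
    exact ⟨rfl, rfl⟩
  · intro he
    apply hk'
    rw [← e3, ← e3, he]
  · intro he
    apply hk
    rw [← e2, ← e2, he]

/-- Unique factorization in the free magma of a left-absorptive law: if the law
`E : x ≃ x ⋄ f(x, y, z)` entails Equation378, then two irreducible words are
`∼_E`-equivalent iff they are the same generator, or they factor as products
with `∼_E`-equivalent corresponding factors. -/
theorem unique_factorization_left_absorptive {X : Type v}
    (f : FreeMagma (Fin 3))
    (hE378 : ∀ (M : Type u) [Mul M], SatLeftAbsorb f M →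
      ∀ x y : M, x * y = (x * y) * y)
    (w w' : FreeMagma X)
    (hw : IrreducibleWord.{u} f w) (hw' : IrreducibleWord.{u} f w') :
    SimE.{u} f w w' ↔
      ((∃ x : X, w = FreeMagma.of x ∧ w' = FreeMagma.of x) ∨
       (∃ w₁ w₂ w₁' w₂' : FreeMagma X, w = w₁ * w₂ ∧ w' = w₁' * w₂' ∧
         SimE.{u} f w₁ w₁' ∧ SimE.{u} f w₂ w₂')) := by
  constructor
  · intro hs
    cases w with
    | of x =>
      cases w' with
      | of y =>
        left
        have hP : SatLeftAbsorb f (ULift.{u} Unit) := fun g => rfl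
        have h1 := congrArg TagMagma.tag (hs (TagMagma (ULift.{u} Unit)) (satTag_aux f _ hP)
          (tagAssign (fun _ => ⟨()⟩) fun z => z = x))
        have h2 := congrArg ULift.down (Sum.inl.inj h1)
        have h3 : y = x := h2.mp rfl
        exact ⟨x, rfl, by rw [h3]⟩
      | mul a b => exact (mixed_aux f x a b hw' hs).elim
    | mul a b =>
      cases w' with
      | of y => exact (mixed_aux f y a b hw (fun M _ hM g => (hs M hM g).symm)).elim
      | mul c d =>
        right
        exact ⟨a, b, c, d, rfl, rfl,
          fun M _ hM g => (prod_aux f a b c d hw hw' hs M hM g).1,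
          fun M _ hM g => (prod_aux f a b c d hw hw' hs M hM g).2⟩
  · rintro (⟨x, rfl, rfl⟩ | ⟨a, b, c, d, rfl, rfl, h1, h2⟩)
    · intro M _ _ g
      rfl
    · intro M _ hM g
      rw [map_mul, map_mul, h1 M hM g, h2 M hM g]
end
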